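/- Consider the hybrid closed-loop single-master–N-slaves teleoperation system under the TOD scheduling protocol. Assume the robot properties P1–P3, the network timing, the TOD protocol with error variables η_i and reset law, the TOD closed-loop dynamics on each interval [t_k, t_{k+1}), and the TOD LMI conditions. If the external forces f_m, f_{s1}, …, f_{sN} are bounded on [t_0, ∞) (i.e. belong to L^∞), then the velocities q̇_m(t) and q̇_{si}(t), i = 1,…,N, are bounded on [t_0, ∞). -/

import Mathlib

open Matrix MeasureTheory Filter Set Finset

noncomputable section

/-- Property P1: the inertia matrix is continuously differentiable (entrywise),
symmetric-valued, and uniformly bounded below and above by positive multiples of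
the identity. -/
def PropP1 {n : ℕ} (M : (Fin n → ℝ) → Matrix (Fin n) (Fin n) ℝ) : Prop :=
  (∀ i j, ContDiff ℝ 1 (fun p : Fin n → ℝ => M p i j)) ∧
  (∀ q, (M q).IsSymm) ∧
  ∃ lm lM : ℝ, 0 < lm ∧ lm ≤ lM ∧
    ∀ q, (M q - lm • (1 : Matrix (Fin n) (Fin n) ℝ)).PosSemidef ∧
      (lM • (1 : Matrix (Fin n) (Fin n) ℝ) - M q).PosSemidef

/-- Property P2: the Coriolis matrix is continuous and, along every C¹ curve,
d/dt[M(q(t))] - 2 C(q(t), q̇(t)) is skew-symmetric. -/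
def PropP2 {n : ℕ} (M : (Fin n → ℝ) → Matrix (Fin n) (Fin n) ℝ)
    (C : (Fin n → ℝ) → (Fin n → ℝ) → Matrix (Fin n) (Fin n) ℝ) : Prop :=
  (∀ i j, Continuous (fun p : (Fin n → ℝ) × (Fin n → ℝ) => C p.1 p.2 i j)) ∧
  ∀ q : ℝ → Fin n → ℝ, ContDiff ℝ 1 q → ∀ t : ℝ,
    (Matrix.of (fun i j => deriv (fun s => M (q s) i j) t)
        - (2 : ℝ) • C (q t) (deriv q t))ᵀ
      = -(Matrix.of (fun i j => deriv (fun s => M (q s) i j) t)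
        - (2 : ℝ) • C (q t) (deriv q t))

/-- Property P3: |C(q,x)·y| ≤ c·|x|·|y|. -/
def PropP3 {n : ℕ}
    (C : (Fin n → ℝ) → (Fin n → ℝ) → Matrix (Fin n) (Fin n) ℝ) : Prop :=
  ∃ c : ℝ, 0 < c ∧ ∀ q x y : Fin n → ℝ, ‖(C q x).mulVec y‖ ≤ c * ‖x‖ * ‖y‖

/-- Property P4: along every curve with bounded velocity and acceleration,
t ↦ C(q(t), q̇(t)) is differentiable with bounded derivative. -/
def PropP4 {n : ℕ}
    (C : (Fin n → ℝ) → (Fin n → ℝ) → Matrix (Fin n) (Fin n) ℝ) : Prop :=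
  ∀ q : ℝ → Fin n → ℝ, ContDiff ℝ 2 q →
    (∃ b, ∀ t, ‖deriv q t‖ ≤ b) → (∃ b, ∀ t, ‖deriv (deriv q) t‖ ≤ b) →
    (∀ i j, Differentiable ℝ (fun t => C (q t) (deriv q t) i j)) ∧
    ∃ b, ∀ t i j, |deriv (fun s => C (q s) (deriv q s) i j) t| ≤ b

/-- The 2n×2n block matrix Ω_i = [[−(1/(N−1))·Q + U, Q], [Q, −G + Q]], where
`c` stands for the real number N. -/
def OmegaTOD {n : ℕ} (c : ℝ) (Qi Ui Gi : Matrix (Fin n) (Fin n) ℝ) :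
    Matrix (Sum (Fin n) (Fin n)) (Sum (Fin n) (Fin n)) ℝ :=
  Matrix.fromBlocks ((-(c - 1)⁻¹) • Qi + Ui) Qi Qi (-Gi + Qi)

/-- The 4n×4n block matrix Π̄_i of the TOD LMI, with diagonal blocks
−2Kᵈ + h_M·R_m, −2Kᵈ + h_M·R_s + h_M·G, −h_M⁻¹·R_m, −h_M⁻¹·R_s and off-diagonal
blocks (1,4) = (2,3) = −Kᵖ (with their symmetric counterparts). -/
def PibarTOD {n : ℕ} (hM : ℝ) (Kp Kd Rm Rs Gi : Matrix (Fin n) (Fin n) ℝ) :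
    Matrix (Fin 4 × Fin n) (Fin 4 × Fin n) ℝ :=
  Matrix.of fun p q =>
    (!![(-2:ℝ) • Kd + hM • Rm, 0, 0, -Kp;
        0, (-2:ℝ) • Kd + hM • Rs + hM • Gi, -Kp, 0;
        0, -Kp, -(hM⁻¹) • Rm, 0;
        -Kp, 0, 0, -(hM⁻¹) • Rs] p.1 q.1) p.2 q.2

/-- The (N−1)n × 4n matrix L_i whose first n-column block vertically stacks the
gains K_jᵖ over the nodes j ≠ i, all other blocks being zero. -/
def LTOD {n N : ℕ} (i : Fin N) (Kp : Fin N → Matrix (Fin n) (Fin n) ℝ) :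
    Matrix ({j : Fin N // j ≠ i} × Fin n) (Fin 4 × Fin n) ℝ :=
  Matrix.of fun p q => if q.1 = 0 then Kp p.1.val p.2 q.2 else 0

/-- The block-diagonal matrix Ψ_i = −h_M⁻¹·diag{U_j : j ≠ i}. -/
def PsiTOD {n N : ℕ} (hM : ℝ) (i : Fin N) (U : Fin N → Matrix (Fin n) (Fin n) ℝ) :
    Matrix ({j : Fin N // j ≠ i} × Fin n) ({j : Fin N // j ≠ i} × Fin n) ℝ :=
  Matrix.of fun p q => if p.1 = q.1 then (-(hM⁻¹)) * U p.1.val p.2 q.2 else 0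

/-- The TOD LMI matrix Σ_i = [[Π̄_i, L_iᵀ], [L_i, Ψ_i]]. -/
def SigmaTOD {n N : ℕ} (hM : ℝ) (i : Fin N) (Kp Kd : Fin N → Matrix (Fin n) (Fin n) ℝ)
    (Rm : Matrix (Fin n) (Fin n) ℝ) (Rs G U : Fin N → Matrix (Fin n) (Fin n) ℝ) :
    Matrix ((Fin 4 × Fin n) ⊕ ({j : Fin N // j ≠ i} × Fin n))
           ((Fin 4 × Fin n) ⊕ ({j : Fin N // j ≠ i} × Fin n)) ℝ :=
  Matrix.fromBlocks (PibarTOD hM (Kp i) (Kd i) Rm (Rs i) (G i)) (LTOD i Kp)ᵀ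
    (LTOD i Kp) (PsiTOD hM i U)

/-- The Lyapunov–Krasovskii functional
V_e(t) = V(t) + V_G(t) + Σᵢ ηᵢᵀQᵢηᵢ + W_e(t) used for the TOD protocol, written
for t in the interval [t_k, t_{k+1}). -/
def VeTOD {n N : ℕ} (hM : ℝ)
    (Mm : (Fin n → ℝ) → Matrix (Fin n) (Fin n) ℝ)
    (Ms : Fin N → (Fin n → ℝ) → Matrix (Fin n) (Fin n) ℝ)
    (Kp : Fin N → Matrix (Fin n) (Fin n) ℝ)
    (Rm : Matrix (Fin n) (Fin n) ℝ)
    (Rs G Q U : Fin N → Matrix (Fin n) (Fin n) ℝ)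
    (γ : Fin N → Fin n → ℝ)
    (qm : ℝ → Fin n → ℝ) (qs : Fin N → ℝ → Fin n → ℝ)
    (η : Fin N → ℝ → Fin n → ℝ)
    (s tk : ℕ → ℝ) (istar : ℕ → Fin N) (k : ℕ) (t : ℝ) : ℝ :=
  -- V(t): kinetic part
  (N : ℝ) * (deriv qm t ⬝ᵥ (Mm (qm t)).mulVec (deriv qm t))
  + ∑ i, deriv (qs i) t ⬝ᵥ (Ms i (qs i t)).mulVec (deriv (qs i) t)
  -- V(t): potential (coordination-error) part
  + ∑ i, (qm t - (qs i t - γ i)) ⬝ᵥ (Kp i).mulVec (qm t - (qs i t - γ i))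
  -- V(t): double-integral delay part
  + (N : ℝ) * ∫ θ in (-hM)..(0:ℝ), ∫ δ in (t+θ)..t,
      deriv qm δ ⬝ᵥ Rm.mulVec (deriv qm δ)
  + ∑ i, ∫ θ in (-hM)..(0:ℝ), ∫ δ in (t+θ)..t,
      deriv (qs i) δ ⬝ᵥ (Rs i).mulVec (deriv (qs i) δ)
  -- V_G(t)
  + hM * ∑ i, ∫ u in (s k)..t, deriv (qs i) u ⬝ᵥ (G i).mulVec (deriv (qs i) u)
  -- η-part
  + ∑ i, η i t ⬝ᵥ (Q i).mulVec (η i t)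
  -- W_e(t)
  + ∑ i ∈ Finset.univ.filter (fun j => j ≠ istar k),
      ((tk k - t) / (tk (k+1) - tk k)) * (η i t ⬝ᵥ (U i).mulVec (η i t))

/-- A uniform positive constant for finitely many downward closed conditions. -/
lemma exists_pos_forall_of_forall_exists_pos {ι : Type*} [Finite ι] {P : ι → ℝ → Prop}
    (hP : ∀ i a b, 0 < a → a ≤ b → P i b → P i a) (h : ∀ i, ∃ a, 0 < a ∧ P i a) :
    ∃ a, 0 < a ∧ ∀ i, P i a := by
  choose f hf hPf using h
  obtain ⟨a, ha, hle⟩ : ∃ a, 0 < a ∧ ∀ i, a ≤ f i := by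
    rcases isEmpty_or_nonempty ι with he | hne
    · exact ⟨1, one_pos, fun i => (he.false i).elim⟩
    · obtain ⟨i, hi⟩ := Finite.exists_min f
      exact ⟨f i, hf i, hi⟩
  exact ⟨a, ha, fun i => hP i a _ ha (hle i) (hPf i)⟩

lemma exists_pos_forall_of_forall_exists_pos' {ι : Type*} [Fintype ι] {P : ι → ℝ → Prop}
    (hP : ∀ i a b, a ≤ b → P i a → P i b) (h : ∀ i, ∃ a, 0 < a ∧ P i a) :
    ∃ a, 0 < a ∧ ∀ i, P i a := by
  choose f hf hPf using h
  refine ⟨1 + ∑ i, f i, by have := Finset.sum_nonneg fun i (_ : i ∈ Finset.univ) => (hf i).le; linarith,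
    fun i => hP i _ _ ?_ (hPf i)⟩
  have := Finset.single_le_sum (f := f) (fun j _ => (hf j).le) (Finset.mem_univ i)
  linarith

lemma Matrix.PosDef.isSymm_real {ι : Type*} {A : Matrix ι ι ℝ} (hA : A.PosDef) : A.IsSymm := by
  have := hA.isHermitian
  rwa [Matrix.IsHermitian, Matrix.conjTranspose_eq_transpose_of_trivial] at this

section Algebra

variable {ι : Type*} [Fintype ι]

lemma abs_dotProduct_le_card_mul (x y : ι → ℝ) :
    |x ⬝ᵥ y| ≤ Fintype.card ι * (‖x‖ * ‖y‖) := by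
  calc |x ⬝ᵥ y| ≤ ∑ i, |x i * y i| := Finset.abs_sum_le_sum_abs _ _
    _ ≤ ∑ _i : ι, ‖x‖ * ‖y‖ := Finset.sum_le_sum fun i _ => by
        rw [abs_mul]
        exact mul_le_mul (norm_le_pi_norm x i) (norm_le_pi_norm y i) (abs_nonneg _) (norm_nonneg _)
    _ = _ := by simp

lemma sq_norm_le_dotProduct_self (x : ι → ℝ) : ‖x‖ ^ 2 ≤ x ⬝ᵥ x := by
  have h0 : 0 ≤ x ⬝ᵥ x := Finset.sum_nonneg fun i _ => mul_self_nonneg _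
  have : ‖x‖ ≤ √(x ⬝ᵥ x) := by
    refine (pi_norm_le_iff_of_nonneg (Real.sqrt_nonneg _)).2 fun i => Real.le_sqrt_of_sq_le ?_
    rw [Real.norm_eq_abs, sq_abs, sq]
    exact Finset.single_le_sum (f := fun i => x i * x i) (fun j _ => mul_self_nonneg _)
      (Finset.mem_univ i)
  calc ‖x‖ ^ 2 ≤ √(x ⬝ᵥ x) ^ 2 := by gcongr
    _ = _ := Real.sq_sqrt h0

lemma exists_norm_mulVec_le (A : Matrix ι ι ℝ) :
    ∃ a, 0 < a ∧ ∀ x, ‖A *ᵥ x‖ ≤ a * ‖x‖ := by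
  refine ⟨‖LinearMap.toContinuousLinearMap A.mulVecLin‖ + 1, by positivity, fun x => ?_⟩
  have := (LinearMap.toContinuousLinearMap A.mulVecLin).le_opNorm x
  simp only [LinearMap.coe_toContinuousLinearMap', Matrix.mulVecLin_apply] at this
  nlinarith [norm_nonneg x]

lemma exists_dotProduct_mulVec_self_le (A : Matrix ι ι ℝ) :
    ∃ a, 0 < a ∧ ∀ x, x ⬝ᵥ A *ᵥ x ≤ a * ‖x‖ ^ 2 := by
  obtain ⟨a, ha, h⟩ := exists_norm_mulVec_le A
  refine ⟨Fintype.card ι * a + 1, by positivity, fun x => ?_⟩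
  have h1 := (le_abs_self _).trans (abs_dotProduct_le_card_mul x (A *ᵥ x))
  have h2 : (Fintype.card ι : ℝ) * (‖x‖ * ‖A *ᵥ x‖) ≤ Fintype.card ι * (‖x‖ * (a * ‖x‖)) := by
    gcongr; exact h x
  nlinarith [sq_nonneg ‖x‖]

lemma Matrix.PosDef.exists_le_dotProduct_mulVec {A : Matrix ι ι ℝ} (hA : A.PosDef) :
    ∃ ε, 0 < ε ∧ ∀ x, ε * ‖x‖ ^ 2 ≤ x ⬝ᵥ A *ᵥ x := by
  have hc : Continuous fun x : ι → ℝ => x ⬝ᵥ A *ᵥ x := by fun_prop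
  have hpos : ∀ x ≠ 0, 0 < x ⬝ᵥ A *ᵥ x := fun x hx => by
    simpa using hA.dotProduct_mulVec_pos hx
  rcases (Metric.sphere (0 : ι → ℝ) 1).eq_empty_or_nonempty with he | hne
  · refine ⟨1, one_pos, fun x => ?_⟩
    by_cases hx : x = 0
    · simp [hx]
    · have : ‖x‖⁻¹ • x ∈ Metric.sphere (0 : ι → ℝ) 1 := by
        simp [norm_smul, hx]
      rw [he] at this
      exact this.elim
  · obtain ⟨y, hy, hmin⟩ := (isCompact_sphere (0 : ι → ℝ) 1).exists_isMinOn hne hc.continuousOn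
    have hy0 : y ≠ 0 := by
      rintro rfl
      simp at hy
    refine ⟨_, hpos y hy0, fun x => ?_⟩
    by_cases hx : x = 0
    · simp [hx]
    · have hmem : ‖x‖⁻¹ • x ∈ Metric.sphere (0 : ι → ℝ) 1 := by
        simp [norm_smul, hx]
      have h1 := hmin hmem
      simp only [Set.mem_ofPred_eq, mulVec_smul, dotProduct_smul, smul_dotProduct, smul_eq_mul] at h1
      have hn : 0 < ‖x‖ := norm_pos_iff.2 hx
      calc _ ≤ (‖x‖⁻¹ * (‖x‖⁻¹ * (x ⬝ᵥ A *ᵥ x))) * ‖x‖ ^ 2 := by gcongr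
        _ = _ := by field_simp

lemma Matrix.IsSymm.dotProduct_mulVec_comm {A : Matrix ι ι ℝ} (hA : A.IsSymm) (x y : ι → ℝ) :
    x ⬝ᵥ A *ᵥ y = y ⬝ᵥ A *ᵥ x := by
  rw [dotProduct_mulVec, ← mulVec_transpose, hA.eq, dotProduct_comm]

lemma Matrix.PosDef.dotProduct_mulVec_self_nonneg {A : Matrix ι ι ℝ} (hA : A.PosDef) (x : ι → ℝ) :
    0 ≤ x ⬝ᵥ A *ᵥ x := by
  simpa using hA.posSemidef.dotProduct_mulVec_nonneg x

end Algebra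

section Calculus

variable {ι : Type*} [Fintype ι]

lemma HasDerivAt.dotProduct_real {x y : ℝ → ι → ℝ} {x' y' : ι → ℝ} {t : ℝ}
    (hx : HasDerivAt x x' t) (hy : HasDerivAt y y' t) :
    HasDerivAt (fun s => x s ⬝ᵥ y s) (x' ⬝ᵥ y t + x t ⬝ᵥ y') t := by
  simp only [dotProduct, ← Finset.sum_add_distrib]
  exact HasDerivAt.fun_sum fun i _ => (hasDerivAt_pi.1 hx i).mul (hasDerivAt_pi.1 hy i)

lemma HasDerivAt.mulVec_real {A : ℝ → Matrix ι ι ℝ} {A' : Matrix ι ι ℝ} {x : ℝ → ι → ℝ}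
    {x' : ι → ℝ} {t : ℝ} (hA : ∀ i j, HasDerivAt (fun s => A s i j) (A' i j) t)
    (hx : HasDerivAt x x' t) :
    HasDerivAt (fun s => A s *ᵥ x s) (A' *ᵥ x t + A t *ᵥ x') t := by
  refine hasDerivAt_pi.2 fun i => ?_
  have := (hasDerivAt_pi.2 (hA i)).dotProduct_real hx
  exact this

lemma HasDerivAt.dotProduct_mulVec_self {A : Matrix ι ι ℝ} (hA : A.IsSymm) {x : ℝ → ι → ℝ}
    {x' : ι → ℝ} {t : ℝ} (hx : HasDerivAt x x' t) :
    HasDerivAt (fun s => x s ⬝ᵥ A *ᵥ x s) (2 * (x' ⬝ᵥ A *ᵥ x t)) t := by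
  have h := hx.dotProduct_real (HasDerivAt.mulVec_real (A := fun _ => A) (A' := 0)
    (fun i j => hasDerivAt_const t _) hx)
  convert h using 1
  rw [zero_mulVec, zero_add, hA.dotProduct_mulVec_comm (x t) x']
  ring

lemma hasDerivAt_integral_of_continuous {φ : ℝ → ℝ} (hφ : Continuous φ) (a t : ℝ) :
    HasDerivAt (fun s => ∫ u in a..s, φ u) (φ t) t :=
  intervalIntegral.integral_hasDerivAt_right (hφ.intervalIntegrable _ _)
    (hφ.stronglyMeasurableAtFilter _ _) hφ.continuousAt

/-- A differential inequality integrates. -/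
lemma sub_le_integral_of_hasDerivAt_le {g g' φ : ℝ → ℝ} {a b : ℝ} (hab : a ≤ b)
    (hφ : Continuous φ) (hg : ∀ t, HasDerivAt g (g' t) t)
    (hle : ∀ t ∈ Set.Ioo a b, g' t ≤ φ t) : g b - g a ≤ ∫ u in a..b, φ u := by
  have hd : ∀ t, HasDerivAt (fun s => g s - ∫ u in a..s, φ u) (g' t - φ t) t := fun t =>
    (hg t).sub (hasDerivAt_integral_of_continuous hφ a t)
  have hanti : AntitoneOn (fun s => g s - ∫ u in a..s, φ u) (Set.Icc a b) := by
    refine antitoneOn_of_deriv_nonpos (convex_Icc a b)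
      (fun t _ => (hd t).continuousAt.continuousWithinAt)
      (fun t _ => (hd t).differentiableAt.differentiableWithinAt) fun t ht => ?_
    rw [(hd t).deriv]
    rw [interior_Icc] at ht
    linarith [hle t ht]
  have := hanti (Set.left_mem_Icc.2 hab) (Set.right_mem_Icc.2 hab) hab
  simp only [intervalIntegral.integral_same] at this
  linarith

lemma integral_mono_interval_of_nonneg {φ : ℝ → ℝ} (hφ : Continuous φ) (h0 : ∀ t, 0 ≤ φ t)
    {a b c d : ℝ} (hca : c ≤ a) (hab : a ≤ b) (hbd : b ≤ d) :
    ∫ u in a..b, φ u ≤ ∫ u in c..d, φ u :=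
  intervalIntegral.integral_mono_interval hca hab hbd
    (Filter.Eventually.of_forall h0) (hφ.intervalIntegrable _ _)

lemma exists_mul_le_integral {φ : ℝ → ℝ} (hφ : Continuous φ) {a b : ℝ} (hab : a ≤ b) :
    ∃ x ∈ Set.Icc a b, (b - a) * φ x ≤ ∫ u in a..b, φ u := by
  obtain ⟨x, hx, hmin⟩ := isCompact_Icc.exists_isMinOn (Set.nonempty_Icc.2 hab) hφ.continuousOn
  refine ⟨x, hx, ?_⟩
  have := intervalIntegral.integral_mono_on (μ := volume) hab (continuous_const.intervalIntegrable a b)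
    (hφ.intervalIntegrable a b) (fun u hu => hmin hu)
  simpa using this

/-- Jensen's inequality for a quadratic form of a primitive. -/
lemma Matrix.PosDef.dotProduct_mulVec_sub_le {A : Matrix ι ι ℝ} (hA : A.PosDef)
    {x v : ℝ → ι → ℝ} (hx : ∀ t, HasDerivAt x (v t) t) (hv : Continuous v) {a b h : ℝ}
    (hab : a ≤ b) (hh : 0 < h) (hbh : b - a ≤ h) :
    h⁻¹ * ((x b - x a) ⬝ᵥ A *ᵥ (x b - x a)) ≤ ∫ u in a..b, v u ⬝ᵥ A *ᵥ v u := by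
  have hs := hA.isSymm_real
  set c : ι → ℝ := h⁻¹ • (x b - x a) with hc
  have hcont : Continuous fun u => v u ⬝ᵥ A *ᵥ v u := by fun_prop
  have hd : ∀ t, HasDerivAt (fun s => 2 * (c ⬝ᵥ A *ᵥ x s) - s * (c ⬝ᵥ A *ᵥ c))
      (2 * (c ⬝ᵥ A *ᵥ v t) - c ⬝ᵥ A *ᵥ c) t := fun t => by
    have h1 := (hasDerivAt_const t c).dotProduct_real
      (HasDerivAt.mulVec_real (A := fun _ => A) (A' := 0) (fun i j => hasDerivAt_const t _) (hx t))
    have h2 := (h1.const_mul 2).sub ((hasDerivAt_id t).mul_const (c ⬝ᵥ A *ᵥ c))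
    refine h2.congr_deriv ?_
    simp
  have key := sub_le_integral_of_hasDerivAt_le hab hcont hd fun t _ => by
    have := hA.dotProduct_mulVec_self_nonneg (v t - c)
    simp only [mulVec_sub, dotProduct_sub, sub_dotProduct] at this
    rw [hs.dotProduct_mulVec_comm (v t) c] at this
    linarith
  have e1 : c ⬝ᵥ A *ᵥ x b - c ⬝ᵥ A *ᵥ x a = h⁻¹ * ((x b - x a) ⬝ᵥ A *ᵥ (x b - x a)) := by
    rw [← dotProduct_sub, ← mulVec_sub, hc, smul_dotProduct, smul_eq_mul]
  have e2 : c ⬝ᵥ A *ᵥ c = h⁻¹ * (h⁻¹ * ((x b - x a) ⬝ᵥ A *ᵥ (x b - x a))) := by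
    rw [hc, smul_dotProduct, mulVec_smul, dotProduct_smul, smul_eq_mul, smul_eq_mul]
  have h3 : (b - a) * (c ⬝ᵥ A *ᵥ c) ≤ h * (c ⬝ᵥ A *ᵥ c) :=
    mul_le_mul_of_nonneg_right hbh (hA.dotProduct_mulVec_self_nonneg c)
  have h4 : h * (c ⬝ᵥ A *ᵥ c) = h⁻¹ * ((x b - x a) ⬝ᵥ A *ᵥ (x b - x a)) := by
    rw [e2]; field_simp
  linarith

lemma sq_norm_sub_le_integral [DecidableEq ι]
    {x v : ℝ → ι → ℝ} (hx : ∀ t, HasDerivAt x (v t) t) (hv : Continuous v) {w : ℝ → ℝ}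
    (hw : Continuous w) (hvw : ∀ t, ‖v t‖ ^ 2 ≤ w t) {a b h : ℝ}
    (hab : a ≤ b) (hh : 0 < h) (hbh : b - a ≤ h) :
    ‖x b - x a‖ ^ 2 ≤ h * Fintype.card ι * ∫ u in a..b, w u := by
  have h1 := (Matrix.PosDef.one (n := ι) (R := ℝ)).dotProduct_mulVec_sub_le hx hv hab hh hbh
  simp only [one_mulVec] at h1
  have h2 : ∫ u in a..b, v u ⬝ᵥ v u ≤ ∫ u in a..b, Fintype.card ι * w u := by
    refine intervalIntegral.integral_mono_on hab
      (Continuous.intervalIntegrable (by fun_prop) _ _)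
      (Continuous.intervalIntegrable (by fun_prop) _ _) fun u _ => ?_
    refine (le_abs_self _).trans ((abs_dotProduct_le_card_mul _ _).trans ?_)
    gcongr
    exact (sq ‖v u‖).symm.le.trans (hvw u)
  rw [intervalIntegral.integral_const_mul] at h2
  have h3 := sq_norm_le_dotProduct_self (x b - x a)
  have h4 := h1.trans h2
  rw [inv_mul_le_iff₀ hh] at h4
  linarith

/-- The single-integral form of the double integral
`∫ θ in (-h)..0, ∫ δ in (t + θ)..t, φ δ`. -/
def delayFunctional (h : ℝ) (φ : ℝ → ℝ) (t : ℝ) : ℝ :=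
  h * (∫ u in (0 : ℝ)..t, φ u) - ∫ τ in (t - h)..t, ∫ u in (0 : ℝ)..τ, φ u

lemma hasDerivAt_delayFunctional {φ : ℝ → ℝ} (hφ : Continuous φ) (h t : ℝ) :
    HasDerivAt (delayFunctional h φ) (h * φ t - ∫ u in (t - h)..t, φ u) t := by
  have hΦ : ∀ t, HasDerivAt (fun s => ∫ u in (0 : ℝ)..s, φ u) (φ t) t :=
    hasDerivAt_integral_of_continuous hφ 0
  have hΦc : Continuous fun s => ∫ u in (0 : ℝ)..s, φ u :=
    continuous_iff_continuousAt.2 fun t => (hΦ t).continuousAt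
  have hΨ := hasDerivAt_integral_of_continuous hΦc 0
  have h1 := (hΨ (t - h)).comp_sub_const t h
  have h2 := ((hΦ t).const_mul h).sub ((hΨ t).sub h1)
  have e : (delayFunctional h φ) = fun s => h * (∫ u in (0 : ℝ)..s, φ u) -
      ((∫ τ in (0 : ℝ)..s, ∫ u in (0 : ℝ)..τ, φ u) -
        ∫ τ in (0 : ℝ)..(s - h), ∫ u in (0 : ℝ)..τ, φ u) := by
    funext s
    rw [delayFunctional, intervalIntegral.integral_interval_sub_left
      (hΦc.intervalIntegrable _ _) (hΦc.intervalIntegrable _ _)]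
  rw [e]
  refine h2.congr_deriv ?_
  rw [intervalIntegral.integral_interval_sub_left
      (hφ.intervalIntegrable _ _) (hφ.intervalIntegrable _ _)]

lemma delayFunctional_bounds {φ : ℝ → ℝ} (hφ : Continuous φ) (h0 : ∀ t, 0 ≤ φ t)
    {h : ℝ} (hh : 0 ≤ h) (t : ℝ) :
    0 ≤ delayFunctional h φ t ∧ delayFunctional h φ t ≤ h * ∫ u in (t - h)..t, φ u := by
  have hΦc : Continuous fun s => ∫ u in (0 : ℝ)..s, φ u :=
    continuous_iff_continuousAt.2 fun t =>
      (hasDerivAt_integral_of_continuous hφ 0 t).continuousAt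
  have hsub : ∀ a b : ℝ, (∫ u in (0 : ℝ)..b, φ u) - (∫ u in (0 : ℝ)..a, φ u) =
      ∫ u in a..b, φ u := fun a b => intervalIntegral.integral_interval_sub_left
      (hφ.intervalIntegrable _ _) (hφ.intervalIntegrable _ _)
  have hle : ∀ a b : ℝ, a ≤ b → (∫ u in (0 : ℝ)..a, φ u) ≤ ∫ u in (0 : ℝ)..b, φ u := by
    intro a b hab
    have := intervalIntegral.integral_nonneg (μ := volume) hab (fun u _ => h0 u)
    linarith [hsub a b]
  have hub := intervalIntegral.integral_mono_on (μ := volume) (a := t - h) (b := t) (by linarith)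
    (hΦc.intervalIntegrable _ _) (continuous_const.intervalIntegrable _ _)
    (fun u hu => hle u t hu.2)
  have hlb := intervalIntegral.integral_mono_on (μ := volume) (a := t - h) (b := t) (by linarith)
    (continuous_const.intervalIntegrable _ _) (hΦc.intervalIntegrable _ _)
    (fun u hu => hle (t - h) u hu.1)
  simp only [intervalIntegral.integral_const, sub_sub_cancel, smul_eq_mul] at hub hlb
  refine ⟨by unfold delayFunctional; linarith, ?_⟩
  rw [← hsub, mul_sub]
  unfold delayFunctional
  linarith

end Calculus

section Robot

variable {n : ℕ} {M : (Fin n → ℝ) → Matrix (Fin n) (Fin n) ℝ}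
  {C : (Fin n → ℝ) → (Fin n → ℝ) → Matrix (Fin n) (Fin n) ℝ}

/-- Along a C² curve the inertia matrix has derivative `C + Cᵀ`. -/
lemma hasDerivAt_inertia (h1 : PropP1 M) (h2 : PropP2 M C) {q : ℝ → Fin n → ℝ}
    (hq : ContDiff ℝ 1 q) (t : ℝ) (i j : Fin n) :
    HasDerivAt (fun s => M (q s) i j)
      ((C (q t) (deriv q t) + (C (q t) (deriv q t))ᵀ) i j) t := by
  have hd : Differentiable ℝ fun s => M (q s) i j :=
    ((h1.1 i j).comp hq).differentiable one_ne_zero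
  refine (hd t).hasDerivAt.congr_deriv ?_
  have hskew := congrFun (congrFun (h2.2 q hq t) i) j
  have hsymm : (fun s => M (q s) j i) = fun s => M (q s) i j :=
    funext fun s => (h1.2.1 (q s)).apply i j
  simp only [transpose_apply, Matrix.sub_apply, Matrix.smul_apply, of_apply, Matrix.neg_apply,
    smul_eq_mul, hsymm] at hskew
  simp only [Matrix.add_apply, transpose_apply]
  linarith

lemma dotProduct_transpose_mulVec (A : Matrix (Fin n) (Fin n) ℝ) (x y : Fin n → ℝ) :
    x ⬝ᵥ Aᵀ *ᵥ y = (A *ᵥ x) ⬝ᵥ y := by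
  rw [dotProduct_mulVec, vecMul_transpose]

lemma hasDerivAt_deriv_of_contDiff_two {q : ℝ → Fin n → ℝ} (hq : ContDiff ℝ 2 q) (t : ℝ) :
    HasDerivAt q (deriv q t) t ∧ HasDerivAt (deriv q) (deriv (deriv q) t) t ∧
      Continuous (deriv q) := by
  have h := (contDiff_succ_iff_deriv (n := 1)).1 hq
  exact ⟨(h.1 t).hasDerivAt, (h.2.2.differentiable one_ne_zero t).hasDerivAt, h.2.2.continuous⟩

/-- Derivative of the generalized momentum tested against a fixed vector. -/
lemma hasDerivAt_momentum (h1 : PropP1 M) (h2 : PropP2 M C) {q : ℝ → Fin n → ℝ}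
    (hq : ContDiff ℝ 2 q) (c : Fin n → ℝ) (t : ℝ) :
    HasDerivAt (fun s => c ⬝ᵥ M (q s) *ᵥ deriv q s)
      ((C (q t) (deriv q t) *ᵥ c) ⬝ᵥ deriv q t +
        c ⬝ᵥ (M (q t) *ᵥ deriv (deriv q) t + C (q t) (deriv q t) *ᵥ deriv q t)) t := by
  have hp := HasDerivAt.mulVec_real (hasDerivAt_inertia h1 h2 (hq.of_le one_le_two) t)
    (hasDerivAt_deriv_of_contDiff_two hq t).2.1
  refine ((hasDerivAt_const t c).dotProduct_real hp).congr_deriv ?_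
  rw [zero_dotProduct, zero_add, add_mulVec, dotProduct_add, dotProduct_add, dotProduct_add,
    dotProduct_transpose_mulVec]
  ring

/-- The power balance of the kinetic energy. -/
lemma hasDerivAt_kinetic (h1 : PropP1 M) (h2 : PropP2 M C) {q : ℝ → Fin n → ℝ}
    (hq : ContDiff ℝ 2 q) (t : ℝ) :
    HasDerivAt (fun s => deriv q s ⬝ᵥ M (q s) *ᵥ deriv q s)
      (2 * (deriv q t ⬝ᵥ (M (q t) *ᵥ deriv (deriv q) t + C (q t) (deriv q t) *ᵥ deriv q t))) t := by
  obtain ⟨-, hv, -⟩ := hasDerivAt_deriv_of_contDiff_two hq t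
  have hp := HasDerivAt.mulVec_real (hasDerivAt_inertia h1 h2 (hq.of_le one_le_two) t) hv
  refine (hv.dotProduct_real hp).congr_deriv ?_
  rw [add_mulVec, dotProduct_add, dotProduct_add, dotProduct_add, dotProduct_transpose_mulVec,
    (h1.2.1 (q t)).dotProduct_mulVec_comm (deriv (deriv q) t),
    dotProduct_comm (_ *ᵥ _) (deriv q t)]
  ring

lemma PropP1.exists_bounds (h1 : PropP1 M) :
    ∃ a b : ℝ, 0 < a ∧ 0 < b ∧ ∀ q x, a * ‖x‖ ^ 2 ≤ x ⬝ᵥ M q *ᵥ x ∧ x ⬝ᵥ M q *ᵥ x ≤ b * ‖x‖ ^ 2 := by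
  obtain ⟨-, -, lm, lM, hlm, hle, h⟩ := h1
  have hlM : 0 < lM := hlm.trans_le hle
  refine ⟨lm, lM * n + 1, hlm, by positivity, fun q x => ?_⟩
  have ha := (h q).1.dotProduct_mulVec_nonneg x
  have hb := (h q).2.dotProduct_mulVec_nonneg x
  simp only [star_trivial, sub_mulVec, smul_mulVec, one_mulVec, dotProduct_sub, dotProduct_smul,
    smul_eq_mul] at ha hb
  have h3 := sq_norm_le_dotProduct_self x
  have h4 := (le_abs_self _).trans (abs_dotProduct_le_card_mul x x)
  rw [Fintype.card_fin] at h4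
  have h5 : lM * (x ⬝ᵥ x) ≤ lM * (n * (‖x‖ * ‖x‖)) := by gcongr
  constructor
  · nlinarith
  · nlinarith [sq_nonneg ‖x‖]

lemma PropP1.abs_dotProduct_mulVec_le (h1 : PropP1 M) {b : ℝ} (hb : 0 < b)
    (hM : ∀ q x, x ⬝ᵥ M q *ᵥ x ≤ b * ‖x‖ ^ 2) (q x y : Fin n → ℝ) :
    |x ⬝ᵥ M q *ᵥ y| ≤ b * (‖x‖ ^ 2 + ‖y‖ ^ 2) := by
  obtain ⟨-, hs, lm, lM, hlm, -, h⟩ := h1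
  have hpos : ∀ z, 0 ≤ z ⬝ᵥ M q *ᵥ z := fun z => by
    have ha := (h q).1.dotProduct_mulVec_nonneg z
    simp only [star_trivial, sub_mulVec, smul_mulVec, one_mulVec, dotProduct_sub, dotProduct_smul,
      smul_eq_mul] at ha
    nlinarith [sq_norm_le_dotProduct_self z, sq_nonneg ‖z‖]
  have e1 := hpos (x - y)
  have e2 := hpos (x + y)
  simp only [mulVec_sub, mulVec_add, dotProduct_sub, dotProduct_add, sub_dotProduct,
    add_dotProduct, (hs q).dotProduct_mulVec_comm y x] at e1 e2
  have e3 := hM q x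
  have e4 := hM q y
  have e5 : 0 ≤ b * ‖x‖ ^ 2 := by positivity
  have e6 : 0 ≤ b * ‖y‖ ^ 2 := by positivity
  rw [abs_le]
  constructor <;> linarith

end Robot

lemma exists_mem_Ico_of_tendsto_atTop {tk : ℕ → ℝ} (htend : Tendsto tk atTop atTop) {t : ℝ}
    (ht : tk 0 ≤ t) : ∃ k, t ∈ Set.Ico (tk k) (tk (k + 1)) := by
  classical
  have hex : ∃ m, t < tk m := (htend.eventually_gt_atTop t).exists
  have hf := Nat.find_spec hex
  rcases hm : Nat.find hex with _ | k
  · rw [hm] at hf; linarith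
  · rw [hm] at hf
    exact ⟨k, not_lt.1 (Nat.find_min hex (by omega)), hf⟩

/-- Energies that dissipate along flows and jumps are bounded as soon as little dissipation over a
long window forces the energy to be moderate somewhere near the end of the window. -/
lemma exists_bound_of_hybrid_dissipation {tk : ℕ → ℝ} (hmono : ∀ k, tk k < tk (k + 1)) {h : ℝ}
    (hgap : ∀ k, tk (k + 1) - tk k ≤ h) (htend : Tendsto tk atTop atTop)
    {E : ℕ → ℝ → ℝ} {w : ℝ → ℝ} {ν : ℕ → ℝ} {c ε : ℝ} (hw : Continuous w) (hw0 : ∀ t, 0 ≤ w t)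
    (hν : ∀ k, 0 ≤ ν k) (hc : 0 ≤ c) (hε : 0 < ε)
    (hflow : ∀ k x y, tk k ≤ x → x ≤ y → y ≤ tk (k + 1) →
      E k y ≤ E k x + c * (y - x) - ε * ∫ u in x..y, w u)
    (hjump : ∀ k, E (k + 1) (tk (k + 1)) ≤ E k (tk (k + 1)) - ε * ν (k + 1))
    (hwin : ∀ L, ∃ B, ∀ a, tk 0 ≤ a → ∫ u in a..(a + 4 * h), w u ≤ L →
      ∃ b ∈ Set.Icc (a + 3 * h) (a + 4 * h), ∀ l, b ∈ Set.Ico (tk l) (tk (l + 1)) → ν l ≤ L →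
        E l b ≤ B) :
    ∃ B, ∀ k, ∀ t ∈ Set.Icc (tk k) (tk (k + 1)), E k t ≤ B := by
  have hsm : StrictMono tk := strictMono_nat_of_lt_succ hmono
  have hh : 0 < h := by linarith [hmono 0, hgap 0]
  have hint : ∀ a b c : ℝ, (∫ u in a..b, w u) + ∫ u in b..c, w u = ∫ u in a..c, w u :=
    fun a b c => intervalIntegral.integral_add_adjacent_intervals (hw.intervalIntegrable _ _)
      (hw.intervalIntegrable _ _)
  have hint0 : ∀ a b : ℝ, a ≤ b → 0 ≤ ∫ u in a..b, w u := fun a b hab =>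
    intervalIntegral.integral_nonneg hab fun u _ => hw0 u
  have hloc := fun t => exists_mem_Ico_of_tendsto_atTop htend (t := t)
  have htel : ∀ j m, E (j + m) (tk (j + m)) ≤ E j (tk j) + c * (tk (j + m) - tk j)
      - ε * (∫ u in tk j..tk (j + m), w u) - ε * ∑ i ∈ Finset.range m, ν (j + i + 1) := by
    intro j m
    induction m with
    | zero => simp
    | succ m ih =>
      have h1 := hflow (j + m) _ _ le_rfl (hmono _).le le_rfl
      have h2 := hjump (j + m)
      rw [Finset.sum_range_succ, ← add_assoc, ← hint (tk j) (tk (j + m))]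
      linarith
  have hstep : ∀ j m, E (j + m) (tk (j + m)) ≤ E j (tk j) + c * (tk (j + m) - tk j) := by
    intro j m
    have h1 := htel j m
    have h2 := mul_nonneg hε.le (hint0 _ _ (hsm.monotone (Nat.le_add_right j m)))
    have h3 := mul_nonneg hε.le (Finset.sum_nonneg fun i (_ : i ∈ Finset.range m) => hν (j + i + 1))
    linarith
  set L : ℝ := c * (5 * h) / ε with hL
  obtain ⟨B₀, hB₀⟩ := hwin L
  set B := max (E 0 (tk 0) + c * (4 * h)) (B₀ + c * (4 * h)) with hB
  have main : ∀ k, E k (tk k) ≤ B := by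
    intro k
    induction k using Nat.strong_induction_on with
    | _ k ih =>
    rcases lt_or_ge (tk k - 4 * h) (tk 0) with hlt | hge
    · refine le_trans ?_ (le_max_left _ _)
      have h1 := hstep 0 k
      rw [Nat.zero_add] at h1
      have : c * (tk k - tk 0) ≤ c * (4 * h) := by gcongr; linarith
      linarith
    · obtain ⟨j, hj⟩ := hloc _ hge
      have hjk : j < k := hsm.lt_iff_lt.1 (by linarith [hj.1])
      by_cases hEj : E k (tk k) ≤ E j (tk j)
      · exact hEj.trans (ih j hjk)
      push Not at hEj
      obtain ⟨m, rfl⟩ := Nat.exists_eq_add_of_lt hjk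
      rw [add_assoc] at *
      have hlen : tk (j + (m + 1)) - tk j ≤ 5 * h := by linarith [hj.2, hgap j]
      have hloss : ε * (∫ u in tk j..tk (j + (m + 1)), w u) +
          ε * ∑ i ∈ Finset.range (m + 1), ν (j + i + 1) ≤ c * (5 * h) := by
        have := htel j (m + 1)
        have h3 : c * (tk (j + (m + 1)) - tk j) ≤ c * (5 * h) := by gcongr
        linarith
      have hI0 := mul_nonneg hε.le (hint0 _ _ (hsm.monotone (Nat.le_add_right j (m + 1))))
      have hS0 := mul_nonneg hε.le
        (Finset.sum_nonneg fun i (_ : i ∈ Finset.range (m + 1)) => hν (j + i + 1))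
      have hI : ∫ u in tk j..tk (j + (m + 1)), w u ≤ L := by
        rw [hL, le_div_iff₀ hε]; linarith
      have hS : ∑ i ∈ Finset.range (m + 1), ν (j + i + 1) ≤ L := by
        rw [hL, le_div_iff₀ hε]; linarith
      obtain ⟨b, hb, hbE⟩ := hB₀ (tk j) (hsm.monotone (Nat.zero_le j))
        ((integral_mono_interval_of_nonneg hw hw0 le_rfl (by linarith) (by linarith [hj.1])).trans hI)
      obtain ⟨l, hl⟩ := hloc b (by linarith [hb.1, hsm.monotone (Nat.zero_le j)])
      have hjl : j < l := by
        have : tk (j + 1) < tk (l + 1) := by linarith [hl.2, hb.1, hgap j]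
        have := hsm.lt_iff_lt.1 this
        omega
      have hlk : l ≤ j + (m + 1) := hsm.le_iff_le.1 (by linarith [hl.1, hb.2, hj.1])
      obtain ⟨i, rfl⟩ := Nat.exists_eq_add_of_lt hjl
      have hνl : ν (j + i + 1) ≤ L := (Finset.single_le_sum
        (f := fun i => ν (j + i + 1)) (fun i _ => hν _) (Finset.mem_range.2 (by omega))).trans hS
      have hEb := hbE _ hl hνl
      refine le_trans ?_ (le_max_right _ _)
      obtain ⟨r, hr⟩ := Nat.exists_eq_add_of_le hlk
      have hfin : E (j + (m + 1)) (tk (j + (m + 1))) ≤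
          E (j + i + 1) b + c * (tk (j + (m + 1)) - b) := by
        rcases r with _ | r
        · have : tk (j + (m + 1)) = b := by
            rw [hr, add_zero]
            rw [add_zero] at hr
            refine le_antisymm hl.1 ?_
            rw [← hr]; linarith [hb.2, hj.1]
          rw [← this]
          rw [hr]
          simp
        · have h1 := hflow _ _ _ hl.1 hl.2.le le_rfl
          have h2 := hjump (j + i + 1)
          have h3 := hstep (j + i + 1 + 1) r
          have e : j + i + 1 + 1 + r = j + (m + 1) := by omega
          rw [e] at h3
          have h4 := mul_nonneg hε.le (hint0 _ _ hl.2.le)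
          have h5 := mul_nonneg hε.le (hν (j + i + 1 + 1))
          linarith
      have : c * (tk (j + (m + 1)) - b) ≤ c * (4 * h) := by
        gcongr; linarith [hb.1]
      linarith
  refine ⟨B + c * h, fun k t ht => ?_⟩
  have h1 := hflow k _ _ le_rfl ht.1 ht.2
  have h2 := mul_nonneg hε.le (hint0 _ _ ht.1)
  have h3 : c * (t - tk k) ≤ c * h := by gcongr; linarith [ht.2, hgap k]
  linarith [main k]

/-- Over a window with little motion, the spring force of a slave robot, and hence its coordination
error, has to be moderate. -/
lemma exists_bound_coordination_error {n : ℕ}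
    {M : (Fin n → ℝ) → Matrix (Fin n) (Fin n) ℝ}
    {C : (Fin n → ℝ) → (Fin n → ℝ) → Matrix (Fin n) (Fin n) ℝ}
    (h1 : PropP1 M) (h2 : PropP2 M C) (h3 : PropP3 C) {qm q : ℝ → Fin n → ℝ}
    (hqm : ContDiff ℝ 2 qm) (hq : ContDiff ℝ 2 q) {Kp Kd : Matrix (Fin n) (Fin n) ℝ}
    (hKp : Kp.PosDef) {γ : Fin n → ℝ} {f : ℝ → Fin n → ℝ} {Δ h t₀ : ℝ} (hh : 0 < h)
    {w : ℝ → ℝ} (hw : Continuous w) (hwm : ∀ t, ‖deriv qm t‖ ^ 2 ≤ w t)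
    (hws : ∀ t, ‖deriv q t‖ ^ 2 ≤ w t)
    (hdyn : ∀ t, t₀ ≤ t → ‖f t‖ ≤ Δ ∧ ∃ σ ∈ Set.Icc (t - h) t, f t =
      M (q t) *ᵥ deriv (deriv q) t + C (q t) (deriv q t) *ᵥ deriv q t + Kd *ᵥ deriv q t
        + Kp *ᵥ ((q t - γ) - qm σ)) (L : ℝ) :
    ∃ B, ∀ a, t₀ ≤ a → ∫ u in a..(a + 4 * h), w u ≤ L →
      ∀ t ∈ Set.Icc (a + 3 * h) (a + 4 * h), ‖qm t - (q t - γ)‖ ≤ B := by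
  obtain ⟨_, b, _, hb, hMb⟩ := h1.exists_bounds
  obtain ⟨κ, hκ, hκle⟩ := hKp.exists_le_dotProduct_mulVec
  obtain ⟨kp, hkp, hkple⟩ := exists_norm_mulVec_le Kp
  obtain ⟨kd, hkd, hkdle⟩ := exists_norm_mulVec_le Kd
  obtain ⟨c₃, hc₃, hc₃le⟩ := h3
  have hw0 : ∀ t, 0 ≤ w t := fun t => (sq_nonneg _).trans (hws t)
  set ρ : ℝ := 1 + 4 * h * n * L with hρ
  set A : ℝ := n * (Δ + kd + 2 * kp * ρ) with hA
  set A' : ℝ := n * (c₃ + kd) with hA'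
  refine ⟨(2 * (b * (1 + L / h)) + 3 * h * A + A' * L) / (κ * h), fun a ha hL t ht => ?_⟩
  have hdiff : ∀ x : ℝ → Fin n → ℝ, ContDiff ℝ 2 x → (∀ t, ‖deriv x t‖ ^ 2 ≤ w t) →
      ∀ τ ∈ Set.Icc a (a + 4 * h), ∀ τ' ∈ Set.Icc a (a + 4 * h), ‖x τ - x τ'‖ ≤ ρ := by
    intro x hx hxw
    have hord : ∀ τ ∈ Set.Icc a (a + 4 * h), ∀ τ' ∈ Set.Icc a (a + 4 * h), τ ≤ τ' →
        ‖x τ' - x τ‖ ≤ ρ := by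
      intro τ hτ τ' hτ' hle
      have key := sq_norm_sub_le_integral (fun t => (hasDerivAt_deriv_of_contDiff_two hx t).1)
        (hasDerivAt_deriv_of_contDiff_two hx 0).2.2 hw hxw hle (h := 4 * h) (by positivity)
        (by linarith [hτ.1, hτ'.2])
      have hi := (integral_mono_interval_of_nonneg hw hw0 hτ.1 hle hτ'.2).trans hL
      rw [Fintype.card_fin] at key
      have : 4 * h * n * ∫ u in τ..τ', w u ≤ 4 * h * n * L := by gcongr
      rw [hρ]
      nlinarith [sq_nonneg (‖x τ' - x τ‖ - 1), norm_nonneg (x τ' - x τ)]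
    intro τ hτ τ' hτ'
    rcases le_total τ τ' with hle | hle
    · rw [norm_sub_rev]; exact hord τ hτ τ' hτ' hle
    · exact hord τ' hτ' τ hτ hle
  have hΔ : 0 ≤ Δ := (norm_nonneg _).trans (hdyn t₀ le_rfl).1
  have hL0 : 0 ≤ L := (intervalIntegral.integral_nonneg (by linarith) fun u _ => hw0 u).trans hL
  have hρ0 : 0 ≤ ρ := by positivity
  obtain ⟨x, hx, hxw⟩ := exists_mul_le_integral hw (a := a + h) (b := a + 2 * h) (by linarith)
  obtain ⟨y, hy, hyw⟩ := exists_mul_le_integral hw (a := a + 3 * h) (b := a + 4 * h) (by linarith)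
  have hwx : w x ≤ L / h := by
    rw [le_div_iff₀ hh]
    have := (integral_mono_interval_of_nonneg hw hw0 (c := a) (d := a + 4 * h)
      (by linarith) (by linarith : a + h ≤ a + 2 * h) (by linarith)).trans hL
    nlinarith
  have hwy : w y ≤ L / h := by
    rw [le_div_iff₀ hh]
    have := (integral_mono_interval_of_nonneg hw hw0 (c := a) (d := a + 4 * h)
      (by linarith) (by linarith : a + 3 * h ≤ a + 4 * h) (by linarith)).trans hL
    nlinarith
  have hxy : x ≤ y := by linarith [hx.2, hy.1]
  set u : Fin n → ℝ := qm t - (q t - γ) with hu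
  set c : Fin n → ℝ := ‖u‖⁻¹ • u with hc
  have hc1 : ‖c‖ ≤ 1 := by
    rw [hc, norm_smul, norm_inv, norm_norm]
    exact inv_mul_le_one
  have hcdot : ∀ z : Fin n → ℝ, |c ⬝ᵥ z| ≤ n * ‖z‖ := fun z => by
    refine (abs_dotProduct_le_card_mul c z).trans ?_
    rw [Fintype.card_fin]
    gcongr
    exact mul_le_of_le_one_left (norm_nonneg _) hc1
  have hcu : κ * ‖u‖ ≤ c ⬝ᵥ Kp *ᵥ u := by
    by_cases h0 : u = 0
    · simp [h0]
    · have hpos : 0 < ‖u‖ := norm_pos_iff.2 h0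
      rw [hc, smul_dotProduct, smul_eq_mul]
      calc κ * ‖u‖ = ‖u‖⁻¹ * (κ * ‖u‖ ^ 2) := by field_simp
        _ ≤ _ := by gcongr; exact hκle u
  have hgb : ∀ z, w z ≤ L / h → |c ⬝ᵥ M (q z) *ᵥ deriv q z| ≤ b * (1 + L / h) := fun z hz => by
    refine (h1.abs_dotProduct_mulVec_le hb (fun q x => (hMb q x).2) _ _ _).trans ?_
    have := hws z
    have : ‖c‖ ^ 2 ≤ 1 := pow_le_one₀ (norm_nonneg _) hc1
    gcongr
    linarith
  have key := sub_le_integral_of_hasDerivAt_le hxy (φ := fun τ => (A - κ * ‖u‖) + A' * w τ)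
    (by fun_prop) (fun τ => (hasDerivAt_momentum h1 h2 hq c τ).neg) fun τ hτ => by
      have hτa : τ ∈ Set.Icc a (a + 4 * h) :=
        ⟨by linarith [hτ.1, hx.1], by linarith [hτ.2, hy.2]⟩
      obtain ⟨hf, σ, hσ, he⟩ := hdyn τ (by linarith [hτa.1])
      have hσa : σ ∈ Set.Icc a (a + 4 * h) :=
        ⟨by linarith [hσ.1, hτ.1, hx.1], by linarith [hσ.2, hτa.2]⟩
      have hta : t ∈ Set.Icc a (a + 4 * h) := ⟨by linarith [ht.1], ht.2⟩
      set r : Fin n → ℝ := (qm t - qm σ) + (q τ - q t) with hr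
      have hr2 : ‖r‖ ≤ ρ + ρ :=
        (norm_add_le _ _).trans (add_le_add (hdiff qm hqm hwm t hta σ hσa)
          (hdiff q hq hws τ hτa t hta))
      have he' : M (q τ) *ᵥ deriv (deriv q) τ + C (q τ) (deriv q τ) *ᵥ deriv q τ =
          f τ - Kd *ᵥ deriv q τ + Kp *ᵥ u - Kp *ᵥ r := by
        have : (q τ - γ) - qm σ = r - u := by rw [hr, hu]; abel
        rw [this, mulVec_sub] at he
        rw [he]; abel
      rw [he', dotProduct_sub, dotProduct_add, dotProduct_sub]
      have b1 := (abs_le.1 (hcdot (f τ))).1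
      have b2 := (abs_le.1 (hcdot (Kd *ᵥ deriv q τ))).2
      have b3 := (abs_le.1 (hcdot (Kp *ᵥ r))).2
      have b4 := (abs_le.1 (abs_dotProduct_le_card_mul (C (q τ) (deriv q τ) *ᵥ c) (deriv q τ))).1
      rw [Fintype.card_fin] at b4
      have hv : ‖deriv q τ‖ ≤ 1 + w τ := by
        nlinarith [sq_nonneg (‖deriv q τ‖ - 1), norm_nonneg (deriv q τ), hws τ]
      have d1 : (n : ℝ) * ‖f τ‖ ≤ n * Δ := by gcongr
      have d2 : (n : ℝ) * ‖Kd *ᵥ deriv q τ‖ ≤ n * (kd * (1 + w τ)) := by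
        gcongr; exact (hkdle _).trans (mul_le_mul_of_nonneg_left hv hkd.le)
      have d3 : (n : ℝ) * ‖Kp *ᵥ r‖ ≤ n * (kp * (ρ + ρ)) := by
        gcongr; exact (hkple _).trans (mul_le_mul_of_nonneg_left hr2 hkp.le)
      have d4 : (n : ℝ) * (‖C (q τ) (deriv q τ) *ᵥ c‖ * ‖deriv q τ‖) ≤ n * (c₃ * w τ) := by
        refine mul_le_mul_of_nonneg_left ?_ n.cast_nonneg
        calc _ ≤ c₃ * ‖deriv q τ‖ * ‖c‖ * ‖deriv q τ‖ := by gcongr; exact hc₃le _ _ _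
          _ ≤ c₃ * ‖deriv q τ‖ * 1 * ‖deriv q τ‖ := by gcongr
          _ = c₃ * ‖deriv q τ‖ ^ 2 := by ring
          _ ≤ _ := by gcongr; exact hws τ
      rw [hA, hA']
      linarith
  rw [intervalIntegral.integral_add (continuous_const.intervalIntegrable _ _)
    (Continuous.intervalIntegrable (by fun_prop) _ _), intervalIntegral.integral_const,
    intervalIntegral.integral_const_mul, smul_eq_mul] at key
  have g1 := (abs_le.1 (hgb x hwx)).1
  have g2 := (abs_le.1 (hgb y hwy)).2
  have hi := (integral_mono_interval_of_nonneg hw hw0 (c := a) (d := a + 4 * h)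
      (by linarith [hx.1]) hxy hy.2).trans hL
  have hi' : A' * (∫ τ in x..y, w τ) ≤ A' * L := by gcongr
  have hA0 : 0 ≤ A := by positivity
  have hyx : (y - x) * A ≤ 3 * h * A := by gcongr; linarith [hy.2, hx.1]
  have hyx' : h * (κ * ‖u‖) ≤ (y - x) * (κ * ‖u‖) := by gcongr; linarith [hy.1, hx.2]
  rw [le_div_iff₀ (by positivity)]
  simp only [Pi.neg_apply] at key
  linarith

section LMI

variable {n N : ℕ}

/-- Strict negativity of the jump LMI as a quadratic estimate. -/
lemma exists_omegaTOD_le {c : ℝ} {Qi Ui Gi : Matrix (Fin n) (Fin n) ℝ} (hQ : Qi.PosDef)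
    (h : (-(OmegaTOD c Qi Ui Gi)).PosDef) :
    ∃ ε, 0 < ε ∧ ∀ x y : Fin n → ℝ,
      -(c - 1)⁻¹ * (x ⬝ᵥ Qi *ᵥ x) + x ⬝ᵥ Ui *ᵥ x + 2 * (x ⬝ᵥ Qi *ᵥ y) - y ⬝ᵥ Gi *ᵥ y
        + y ⬝ᵥ Qi *ᵥ y ≤ -(ε * (‖x‖ ^ 2 + ‖y‖ ^ 2)) := by
  obtain ⟨ε, hε, hle⟩ := h.exists_le_dotProduct_mulVec
  refine ⟨ε / 2, by positivity, fun x y => ?_⟩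
  have key := hle (Sum.elim x y)
  rw [neg_mulVec, dotProduct_neg, OmegaTOD, fromBlocks_mulVec, sumElim_dotProduct_sumElim] at key
  simp only [Sum.elim_comp_inl, Sum.elim_comp_inr, add_mulVec, neg_mulVec, smul_mulVec,
    dotProduct_add, dotProduct_smul, dotProduct_neg, smul_eq_mul,
    hQ.isSymm_real.dotProduct_mulVec_comm y x] at key
  have hx : ‖x‖ ^ 2 ≤ ‖Sum.elim x y‖ ^ 2 := by
    gcongr
    exact (pi_norm_le_iff_of_nonneg (norm_nonneg _)).2 fun i =>
      norm_le_pi_norm (Sum.elim x y) (Sum.inl i)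
  have hy : ‖y‖ ^ 2 ≤ ‖Sum.elim x y‖ ^ 2 := by
    gcongr
    exact (pi_norm_le_iff_of_nonneg (norm_nonneg _)).2 fun i =>
      norm_le_pi_norm (Sum.elim x y) (Sum.inr i)
  nlinarith

lemma dotProduct_mulVec_of_blocks {κ : Type*} [Fintype κ]
    (B : κ → κ → Matrix (Fin n) (Fin n) ℝ) (x : κ → Fin n → ℝ) :
    (fun p : κ × Fin n => x p.1 p.2) ⬝ᵥ
        (Matrix.of fun p q : κ × Fin n => B p.1 q.1 p.2 q.2) *ᵥ (fun p : κ × Fin n => x p.1 p.2) =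
      ∑ a, ∑ b, x a ⬝ᵥ B a b *ᵥ x b := by
  simp only [dotProduct, mulVec, Fintype.sum_prod_type, of_apply, Finset.mul_sum]
  exact Finset.sum_congr rfl fun a _ => Finset.sum_comm

/-- Strict negativity of the flow LMI as a quadratic estimate. -/
lemma exists_sigmaTOD_le {h : ℝ} (i : Fin N) {Kp Kd : Fin N → Matrix (Fin n) (Fin n) ℝ}
    {Rm : Matrix (Fin n) (Fin n) ℝ} {Rs G U : Fin N → Matrix (Fin n) (Fin n) ℝ}
    (hKp : ∀ i, (Kp i).PosDef) (hS : (-(SigmaTOD h i Kp Kd Rm Rs G U)).PosDef) :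
    ∃ ε, 0 < ε ∧ ∀ (x₁ x₂ x₃ x₄ : Fin n → ℝ) (y : Fin N → Fin n → ℝ),
      -2 * (x₁ ⬝ᵥ Kd i *ᵥ x₁) + h * (x₁ ⬝ᵥ Rm *ᵥ x₁) - 2 * (x₂ ⬝ᵥ Kd i *ᵥ x₂)
        + h * (x₂ ⬝ᵥ Rs i *ᵥ x₂) + h * (x₂ ⬝ᵥ G i *ᵥ x₂) - h⁻¹ * (x₃ ⬝ᵥ Rm *ᵥ x₃)
        - h⁻¹ * (x₄ ⬝ᵥ Rs i *ᵥ x₄) - 2 * (x₁ ⬝ᵥ Kp i *ᵥ x₄) - 2 * (x₂ ⬝ᵥ Kp i *ᵥ x₃)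
        + ∑ j ∈ Finset.univ.filter (fun j => j ≠ i),
          (2 * (x₁ ⬝ᵥ Kp j *ᵥ y j) - h⁻¹ * (y j ⬝ᵥ U j *ᵥ y j))
      ≤ -(ε * (‖x₁‖ ^ 2 + ‖x₂‖ ^ 2)) := by
  obtain ⟨ε, hε, hle⟩ := hS.exists_le_dotProduct_mulVec
  refine ⟨ε / 2, by positivity, fun x₁ x₂ x₃ x₄ y => ?_⟩
  set X : Fin 4 × Fin n → ℝ := fun p => ![x₁, x₂, x₃, x₄] p.1 p.2 with hX
  set Y : {j : Fin N // j ≠ i} × Fin n → ℝ := fun p => y p.1.val p.2 with hY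
  have key := hle (Sum.elim X Y)
  have hpi : X ⬝ᵥ PibarTOD h (Kp i) (Kd i) Rm (Rs i) (G i) *ᵥ X =
      -2 * (x₁ ⬝ᵥ Kd i *ᵥ x₁) + h * (x₁ ⬝ᵥ Rm *ᵥ x₁) - 2 * (x₂ ⬝ᵥ Kd i *ᵥ x₂)
        + h * (x₂ ⬝ᵥ Rs i *ᵥ x₂) + h * (x₂ ⬝ᵥ G i *ᵥ x₂) - h⁻¹ * (x₃ ⬝ᵥ Rm *ᵥ x₃)
        - h⁻¹ * (x₄ ⬝ᵥ Rs i *ᵥ x₄) - 2 * (x₁ ⬝ᵥ Kp i *ᵥ x₄) - 2 * (x₂ ⬝ᵥ Kp i *ᵥ x₃) := by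
    refine (dotProduct_mulVec_of_blocks
      ![![(-2 : ℝ) • Kd i + h • Rm, 0, 0, -Kp i],
        ![0, (-2 : ℝ) • Kd i + h • Rs i + h • G i, -Kp i, 0],
        ![0, -Kp i, -(h⁻¹) • Rm, 0],
        ![-Kp i, 0, 0, -(h⁻¹) • Rs i]] ![x₁, x₂, x₃, x₄]).trans ?_
    simp only [Fin.sum_univ_four, cons_val', cons_val_zero, cons_val_one, Matrix.cons_val,
      add_mulVec, neg_mulVec, smul_mulVec, zero_mulVec, dotProduct_add, dotProduct_smul,
      dotProduct_neg, dotProduct_zero, smul_eq_mul,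
      (hKp i).isSymm_real.dotProduct_mulVec_comm x₄ x₁,
      (hKp i).isSymm_real.dotProduct_mulVec_comm x₃ x₂]
    ring
  have hsub : ∀ g : Fin N → ℝ, ∑ j : {j : Fin N // j ≠ i}, g j.val =
      ∑ j ∈ Finset.univ.filter (fun j => j ≠ i), g j := fun g =>
    (Finset.sum_subtype _ (by simp) g).symm
  have hL : Y ⬝ᵥ LTOD i Kp *ᵥ X =
      ∑ j ∈ Finset.univ.filter (fun j => j ≠ i), x₁ ⬝ᵥ Kp j *ᵥ y j := by
    rw [← hsub]
    have : ∀ p : {j : Fin N // j ≠ i} × Fin n, (LTOD i Kp *ᵥ X) p = (Kp p.1.val *ᵥ x₁) p.2 := by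
      intro p
      simp [LTOD, mulVec, dotProduct, Fintype.sum_prod_type, hX]
    simp only [(hKp _).isSymm_real.dotProduct_mulVec_comm x₁]
    simp only [dotProduct, this, Fintype.sum_prod_type, hY]
  have hP : Y ⬝ᵥ PsiTOD h i U *ᵥ Y =
      -(h⁻¹ * ∑ j ∈ Finset.univ.filter (fun j => j ≠ i), y j ⬝ᵥ U j *ᵥ y j) := by
    rw [← hsub]
    have := dotProduct_mulVec_of_blocks (fun a b : {j : Fin N // j ≠ i} =>
      if a = b then (-(h⁻¹)) • U a.val else 0) (fun a => y a.val)
    have e : PsiTOD h i U = Matrix.of fun p q : {j : Fin N // j ≠ i} × Fin n =>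
        (if p.1 = q.1 then (-(h⁻¹)) • U p.1.val else 0) p.2 q.2 := by
      ext p q
      simp only [PsiTOD, of_apply]
      split_ifs <;> simp
    rw [e, hY, this, Finset.mul_sum, ← Finset.sum_neg_distrib]
    refine Finset.sum_congr rfl fun a _ => ?_
    rw [Finset.sum_eq_single a (fun b _ hb => by simp [hb.symm]) (by simp)]
    simp [neg_mulVec, smul_mulVec]
  rw [neg_mulVec, dotProduct_neg, SigmaTOD, fromBlocks_mulVec, sumElim_dotProduct_sumElim] at key
  simp only [Sum.elim_comp_inl, Sum.elim_comp_inr, dotProduct_add] at key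
  have hLt : X ⬝ᵥ (LTOD i Kp)ᵀ *ᵥ Y = Y ⬝ᵥ LTOD i Kp *ᵥ X := by
    rw [dotProduct_mulVec, vecMul_transpose, dotProduct_comm]
  rw [hLt, hpi, hL, hP] at key
  have hx : ‖x₁‖ ^ 2 ≤ ‖Sum.elim X Y‖ ^ 2 := by
    gcongr
    exact (pi_norm_le_iff_of_nonneg (norm_nonneg _)).2 fun l =>
      norm_le_pi_norm (Sum.elim X Y) (Sum.inl (0, l))
  have hy : ‖x₂‖ ^ 2 ≤ ‖Sum.elim X Y‖ ^ 2 := by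
    gcongr
    exact (pi_norm_le_iff_of_nonneg (norm_nonneg _)).2 fun l =>
      norm_le_pi_norm (Sum.elim X Y) (Sum.inl (1, l))
  rw [Finset.sum_sub_distrib, ← Finset.mul_sum, ← Finset.mul_sum]
  nlinarith

/-- The summed dissipation inequality along flows. -/
lemma exists_sum_sigmaTOD_le {h : ℝ} (hN : 1 ≤ N) {Kp Kd : Fin N → Matrix (Fin n) (Fin n) ℝ}
    {Rm : Matrix (Fin n) (Fin n) ℝ} {Rs G U : Fin N → Matrix (Fin n) (Fin n) ℝ}
    (hKp : ∀ i, (Kp i).PosDef) (hS : ∀ i, (-(SigmaTOD h i Kp Kd Rm Rs G U)).PosDef) :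
    ∃ ε, 0 < ε ∧ ∀ (l : Fin N) (vm am : Fin n → ℝ) (vs as y : Fin N → Fin n → ℝ),
      ∑ i, (-2 * (vm ⬝ᵥ Kd i *ᵥ vm) + h * (vm ⬝ᵥ Rm *ᵥ vm) - 2 * (vs i ⬝ᵥ Kd i *ᵥ vs i)
        + h * (vs i ⬝ᵥ Rs i *ᵥ vs i) + h * (vs i ⬝ᵥ G i *ᵥ vs i) - h⁻¹ * (am ⬝ᵥ Rm *ᵥ am)
        - h⁻¹ * (as i ⬝ᵥ Rs i *ᵥ as i) - 2 * (vm ⬝ᵥ Kp i *ᵥ as i) - 2 * (vs i ⬝ᵥ Kp i *ᵥ am))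
        + ∑ j ∈ Finset.univ.filter (fun j => j ≠ l),
          (2 * (vm ⬝ᵥ Kp j *ᵥ y j) - h⁻¹ * (y j ⬝ᵥ U j *ᵥ y j))
      ≤ -(ε * (‖vm‖ ^ 2 + ∑ i, ‖vs i‖ ^ 2)) := by
  obtain ⟨ε, hε, hle⟩ := exists_pos_forall_of_forall_exists_pos
    (P := fun i ε => ∀ (x₁ x₂ x₃ x₄ : Fin n → ℝ) (y : Fin N → Fin n → ℝ),
      -2 * (x₁ ⬝ᵥ Kd i *ᵥ x₁) + h * (x₁ ⬝ᵥ Rm *ᵥ x₁) - 2 * (x₂ ⬝ᵥ Kd i *ᵥ x₂)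
        + h * (x₂ ⬝ᵥ Rs i *ᵥ x₂) + h * (x₂ ⬝ᵥ G i *ᵥ x₂) - h⁻¹ * (x₃ ⬝ᵥ Rm *ᵥ x₃)
        - h⁻¹ * (x₄ ⬝ᵥ Rs i *ᵥ x₄) - 2 * (x₁ ⬝ᵥ Kp i *ᵥ x₄) - 2 * (x₂ ⬝ᵥ Kp i *ᵥ x₃)
        + ∑ j ∈ Finset.univ.filter (fun j => j ≠ i),
          (2 * (x₁ ⬝ᵥ Kp j *ᵥ y j) - h⁻¹ * (y j ⬝ᵥ U j *ᵥ y j))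
      ≤ -(ε * (‖x₁‖ ^ 2 + ‖x₂‖ ^ 2)))
    (fun i a b _ hab hb x₁ x₂ x₃ x₄ y => (hb x₁ x₂ x₃ x₄ y).trans (by gcongr))
    (fun i => exists_sigmaTOD_le i hKp (hS i))
  refine ⟨ε, hε, fun l vm am vs as y => ?_⟩
  have key := Finset.sum_le_sum fun i (_ : i ∈ Finset.univ) =>
    hle i vm (vs i) am (as i) (fun j => if i = l then y j else 0)
  have hsum : ∑ i, ∑ j ∈ Finset.univ.filter (fun j => j ≠ i),
      (2 * (vm ⬝ᵥ Kp j *ᵥ (if i = l then y j else 0))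
        - h⁻¹ * ((if i = l then y j else 0) ⬝ᵥ U j *ᵥ (if i = l then y j else 0))) =
      ∑ j ∈ Finset.univ.filter (fun j => j ≠ l),
          (2 * (vm ⬝ᵥ Kp j *ᵥ y j) - h⁻¹ * (y j ⬝ᵥ U j *ᵥ y j)) := by
    rw [Finset.sum_eq_single l (fun i _ hi => by simp [hi]) (by simp)]
    simp
  rw [Finset.sum_add_distrib, hsum] at key
  refine key.trans ?_
  rw [Finset.sum_neg_distrib, ← Finset.mul_sum, neg_le_neg_iff, Finset.sum_add_distrib]
  have hN' : (1 : ℝ) ≤ N := by exact_mod_cast hN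
  gcongr
  rw [Finset.sum_const, Finset.card_univ, Fintype.card_fin, nsmul_eq_mul]
  exact le_mul_of_one_le_left (sq_nonneg _) hN'

/-- The decrease of the network-error terms at a TOD transmission. -/
lemma exists_sum_omegaTOD_le (hN : 2 ≤ N) {Q U G : Fin N → Matrix (Fin n) (Fin n) ℝ}
    (hQ : ∀ i, (Q i).PosDef) (hΩ : ∀ i, (-(OmegaTOD (N : ℝ) (Q i) (U i) (G i))).PosDef) :
    ∃ ε, 0 < ε ∧ ∀ (l : Fin N) (y d z : Fin N → Fin n → ℝ),
      (∀ i, y i ⬝ᵥ Q i *ᵥ y i ≤ y l ⬝ᵥ Q l *ᵥ y l) →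
      (∀ i, z i = (if i = l then 0 else y i) + d i) →
      ∑ i, z i ⬝ᵥ Q i *ᵥ z i - ∑ i, y i ⬝ᵥ Q i *ᵥ y i
        + ∑ i ∈ Finset.univ.filter (fun j => j ≠ l), y i ⬝ᵥ U i *ᵥ y i
        - ∑ i, d i ⬝ᵥ G i *ᵥ d i ≤ -(ε * ∑ i, ‖z i‖ ^ 2) := by
  obtain ⟨ε, hε, hle⟩ := exists_pos_forall_of_forall_exists_pos
    (P := fun i ε => ∀ x y : Fin n → ℝ,
      -((N : ℝ) - 1)⁻¹ * (x ⬝ᵥ Q i *ᵥ x) + x ⬝ᵥ U i *ᵥ x + 2 * (x ⬝ᵥ Q i *ᵥ y)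
        - y ⬝ᵥ G i *ᵥ y + y ⬝ᵥ Q i *ᵥ y ≤ -(ε * (‖x‖ ^ 2 + ‖y‖ ^ 2)))
    (fun i a b _ hab hb x y => (hb x y).trans (by gcongr))
    (fun i => exists_omegaTOD_le (hQ i) (hΩ i))
  refine ⟨ε / 2, by positivity, fun l y d z hmax hz => ?_⟩
  have hN' : (0 : ℝ) < N - 1 := by
    have : (2 : ℝ) ≤ N := by exact_mod_cast hN
    linarith
  set x : Fin N → Fin n → ℝ := fun i => if i = l then 0 else y i with hx
  have hzx : ∀ i, z i = x i + d i := hz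
  have key := Finset.sum_le_sum fun i (_ : i ∈ Finset.univ) => hle i (x i) (d i)
  have hzQ : ∀ i, z i ⬝ᵥ Q i *ᵥ z i =
      x i ⬝ᵥ Q i *ᵥ x i + 2 * (x i ⬝ᵥ Q i *ᵥ d i) + d i ⬝ᵥ Q i *ᵥ d i := fun i => by
    rw [hzx, mulVec_add, dotProduct_add, add_dotProduct, add_dotProduct,
      (hQ i).isSymm_real.dotProduct_mulVec_comm (d i) (x i)]
    ring
  have hzn : ∑ i, ‖z i‖ ^ 2 ≤ 2 * ∑ i, (‖x i‖ ^ 2 + ‖d i‖ ^ 2) := by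
    rw [Finset.mul_sum]
    refine Finset.sum_le_sum fun i _ => ?_
    have : ‖z i‖ ^ 2 ≤ (‖x i‖ + ‖d i‖) ^ 2 := by
      gcongr
      rw [hzx]
      exact norm_add_le _ _
    nlinarith [sq_nonneg (‖x i‖ - ‖d i‖)]
  have hfilter : ∀ A : Fin N → Matrix (Fin n) (Fin n) ℝ, ∑ i, x i ⬝ᵥ A i *ᵥ x i =
      ∑ i ∈ Finset.univ.filter (fun j => j ≠ l), y i ⬝ᵥ A i *ᵥ y i := fun A => by
    rw [Finset.sum_filter]
    refine Finset.sum_congr rfl fun i _ => ?_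
    by_cases h : i = l <;> simp [hx, h]
  have hsplit : ∑ i, y i ⬝ᵥ Q i *ᵥ y i = y l ⬝ᵥ Q l *ᵥ y l + ∑ i, x i ⬝ᵥ Q i *ᵥ x i := by
    rw [hfilter, Finset.filter_ne',
      Finset.add_sum_erase _ (fun i => y i ⬝ᵥ Q i *ᵥ y i) (Finset.mem_univ l)]
  have hbound : ((N : ℝ) - 1)⁻¹ * ∑ i, x i ⬝ᵥ Q i *ᵥ x i ≤ y l ⬝ᵥ Q l *ᵥ y l := by
    rw [inv_mul_le_iff₀ hN', hfilter]
    refine (Finset.sum_le_card_nsmul _ _ _ fun i _ => hmax i).trans ?_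
    rw [Finset.filter_ne', Finset.card_erase_of_mem (Finset.mem_univ l), Finset.card_univ,
      Fintype.card_fin, nsmul_eq_mul, Nat.cast_sub (by omega), Nat.cast_one]
  simp only [Finset.sum_add_distrib, Finset.sum_sub_distrib, Finset.sum_neg_distrib,
    ← Finset.mul_sum] at key hzn
  rw [← hfilter U, hsplit]
  simp only [hzQ, Finset.sum_add_distrib, ← Finset.mul_sum]
  nlinarith

/-- The jump LMI bounds the weights `U` by the weights `Q`. -/
lemma dotProduct_mulVec_le_of_omegaTOD (hN : 2 ≤ N) {Qi Ui Gi : Matrix (Fin n) (Fin n) ℝ}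
    (hQ : Qi.PosDef) (hΩ : (-(OmegaTOD (N : ℝ) Qi Ui Gi)).PosDef) (x : Fin n → ℝ) :
    x ⬝ᵥ Ui *ᵥ x ≤ x ⬝ᵥ Qi *ᵥ x := by
  obtain ⟨ε, hε, h⟩ := exists_omegaTOD_le hQ hΩ
  have h1 := h x 0
  simp only [mulVec_zero, dotProduct_zero] at h1
  have h2 : ((N : ℝ) - 1)⁻¹ ≤ 1 := by
    have : (2 : ℝ) ≤ N := by exact_mod_cast hN
    exact inv_le_one_of_one_le₀ (by linarith)
  have h3 := mul_le_mul_of_nonneg_right h2 (hQ.dotProduct_mulVec_self_nonneg x)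
  have h4 : 0 ≤ ε * (‖x‖ ^ 2 + ‖(0 : Fin n → ℝ)‖ ^ 2) := by positivity
  linarith

end LMI

section Flow

variable {n N : ℕ}

/-- The bounded forces and constant offsets enter the dissipation inequality only through an
additive constant. -/
lemma exists_linear_sub_quadratic_le (hN : 1 ≤ N) {ε : ℝ} (hε : 0 < ε) (Δ : ℝ) (g : Fin n → ℝ) :
    ∃ c, 0 ≤ c ∧ ∀ (vm fm : Fin n → ℝ) (vs fs : Fin N → Fin n → ℝ), ‖fm‖ ≤ Δ →
      (∀ i, ‖fs i‖ ≤ Δ) → 2 * N * (vm ⬝ᵥ fm) + 2 * (vm ⬝ᵥ g) + ∑ i, 2 * (vs i ⬝ᵥ fs i)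
        - ε * (‖vm‖ ^ 2 + ∑ i, ‖vs i‖ ^ 2)
      ≤ c - ε / 2 * (‖vm‖ ^ 2 + ∑ i, ‖vs i‖ ^ 2) := by
  have hY : ∀ a b : ℝ, a * b ≤ ε / 2 * b ^ 2 + a ^ 2 / (2 * ε) := fun a b => by
    have : ε / 2 * b ^ 2 + a ^ 2 / (2 * ε) - a * b = (ε * b - a) ^ 2 / (2 * ε) := by
      field_simp; ring
    have := div_nonneg (sq_nonneg (ε * b - a)) (by positivity : (0 : ℝ) ≤ 2 * ε)
    linarith
  have hdot : ∀ (x y : Fin n → ℝ) (D : ℝ), ‖y‖ ≤ D → x ⬝ᵥ y ≤ n * D * ‖x‖ := fun x y D hy => by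
    have h1 := (le_abs_self _).trans (abs_dotProduct_le_card_mul x y)
    rw [Fintype.card_fin] at h1
    have h2 : (n : ℝ) * (‖x‖ * ‖y‖) ≤ n * (‖x‖ * D) := by gcongr
    linarith
  set a : ℝ := 2 * N * (n * Δ) + 2 * (n * ‖g‖)
  set b : ℝ := 2 * (n * Δ)
  refine ⟨a ^ 2 / (2 * ε) + N * (b ^ 2 / (2 * ε)), by positivity, fun vm fm vs fs hfm hfs => ?_⟩
  have h1 : 2 * N * (vm ⬝ᵥ fm) + 2 * (vm ⬝ᵥ g) ≤ a * ‖vm‖ := by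
    have h2 := mul_le_mul_of_nonneg_left (hdot vm fm Δ hfm) (by positivity : (0 : ℝ) ≤ 2 * N)
    have h3 := hdot vm g _ le_rfl
    simp only [a]; linarith
  have h4 : ∑ i, 2 * (vs i ⬝ᵥ fs i) ≤ ∑ i, (ε / 2 * ‖vs i‖ ^ 2 + b ^ 2 / (2 * ε)) :=
    Finset.sum_le_sum fun i _ => by
      have := hdot (vs i) (fs i) Δ (hfs i)
      have h5 := hY b ‖vs i‖
      simp only [b] at h5 ⊢; linarith
  rw [Finset.sum_add_distrib, ← Finset.mul_sum Finset.univ (fun i => ‖vs i‖ ^ 2), Finset.sum_const,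
    Finset.card_univ, Fintype.card_fin, nsmul_eq_mul] at h4
  have h6 := hY a ‖vm‖
  linarith

/-- The closed-loop equations at a fixed time turn the Lyapunov derivative into the quadratic
form of the flow LMI plus force terms. -/
lemma exists_flow_dissipation {h : ℝ} (hN : 1 ≤ N) {Kp Kd : Fin N → Matrix (Fin n) (Fin n) ℝ}
    {Rm : Matrix (Fin n) (Fin n) ℝ} {Rs G U : Fin N → Matrix (Fin n) (Fin n) ℝ}
    (hKp : ∀ i, (Kp i).PosDef) (hS : ∀ i, (-(SigmaTOD h i Kp Kd Rm Rs G U)).PosDef)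
    (γ : Fin N → Fin n → ℝ) (Δ : ℝ) :
    ∃ c ε, 0 ≤ c ∧ 0 < ε ∧ ∀ (l : Fin N) (vm am fm Xm : Fin n → ℝ)
      (vs as e y fs Xs : Fin N → Fin n → ℝ), ‖fm‖ ≤ Δ → (∀ i, ‖fs i‖ ≤ Δ) →
      fm = Xm + (N : ℝ)⁻¹ • (∑ i, Kd i *ᵥ vm)
        - (N : ℝ)⁻¹ • (∑ i ∈ Finset.univ.filter (fun j => j ≠ l), Kp i *ᵥ y i)
        + (N : ℝ)⁻¹ • (∑ i, Kp i *ᵥ (e i - γ i + as i)) →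
      (∀ i, fs i = Xs i + Kd i *ᵥ vs i + Kp i *ᵥ (am - e i)) →
      N * (2 * (vm ⬝ᵥ Xm)) + ∑ i, 2 * (vs i ⬝ᵥ Xs i) + ∑ i, 2 * ((vm - vs i) ⬝ᵥ Kp i *ᵥ e i)
        + N * (h * (vm ⬝ᵥ Rm *ᵥ vm) - h⁻¹ * (am ⬝ᵥ Rm *ᵥ am))
        + ∑ i, (h * (vs i ⬝ᵥ Rs i *ᵥ vs i) - h⁻¹ * (as i ⬝ᵥ Rs i *ᵥ as i))
        + h * ∑ i, vs i ⬝ᵥ G i *ᵥ vs i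
        - h⁻¹ * ∑ i ∈ Finset.univ.filter (fun j => j ≠ l), y i ⬝ᵥ U i *ᵥ y i
      ≤ c - ε * (‖vm‖ ^ 2 + ∑ i, ‖vs i‖ ^ 2) := by
  obtain ⟨ε, hε, hLMI⟩ := exists_sum_sigmaTOD_le hN hKp hS
  obtain ⟨c, hc, hforce⟩ := exists_linear_sub_quadratic_le hN hε Δ (∑ i, Kp i *ᵥ γ i)
  refine ⟨c, ε / 2, hc, by positivity, fun l vm am fm Xm vs as e y fs Xs hfm hfs hdm hds => ?_⟩
  have hN0 : (N : ℝ) ≠ 0 := by positivity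
  have h1 : N * (2 * (vm ⬝ᵥ Xm)) = 2 * N * (vm ⬝ᵥ fm) - 2 * ∑ i, vm ⬝ᵥ Kd i *ᵥ vm
      + 2 * ∑ i ∈ Finset.univ.filter (fun j => j ≠ l), vm ⬝ᵥ Kp i *ᵥ y i
      - 2 * ∑ i, (vm ⬝ᵥ Kp i *ᵥ e i - vm ⬝ᵥ Kp i *ᵥ γ i + vm ⬝ᵥ Kp i *ᵥ as i) := by
    rw [hdm]
    simp only [dotProduct_add, dotProduct_sub, dotProduct_smul, dotProduct_sum, smul_eq_mul,
      mulVec_add, mulVec_sub]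
    field_simp
    ring
  have h2 : ∀ i, 2 * (vs i ⬝ᵥ Xs i) = 2 * (vs i ⬝ᵥ fs i) - 2 * (vs i ⬝ᵥ Kd i *ᵥ vs i)
      - 2 * (vs i ⬝ᵥ Kp i *ᵥ am) + 2 * (vs i ⬝ᵥ Kp i *ᵥ e i) := fun i => by
    rw [hds i]
    simp only [dotProduct_add, dotProduct_sub, mulVec_sub]
    ring
  have h3 := hLMI l vm am vs as y
  have h4 := hforce vm fm vs fs hfm hfs
  simp only [h1, h2, sub_dotProduct, mul_sub, Finset.sum_add_distrib, Finset.sum_sub_distrib,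
    ← Finset.mul_sum, dotProduct_sum, Finset.sum_const, Finset.card_univ, Fintype.card_fin,
    nsmul_eq_mul] at h3 h4 ⊢
  linarith

end Flow

section Storage

variable {n N : ℕ}

/-- The part of the Lyapunov–Krasovskii functional that does not depend on the network events:
kinetic energy, potential energy of the coordination errors and the delay terms. -/
def teleopStorage (h : ℝ) (Mm : (Fin n → ℝ) → Matrix (Fin n) (Fin n) ℝ)
    (Ms : Fin N → (Fin n → ℝ) → Matrix (Fin n) (Fin n) ℝ)
    (Kp : Fin N → Matrix (Fin n) (Fin n) ℝ) (Rm : Matrix (Fin n) (Fin n) ℝ)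
    (Rs : Fin N → Matrix (Fin n) (Fin n) ℝ) (γ : Fin N → Fin n → ℝ)
    (qm : ℝ → Fin n → ℝ) (qs : Fin N → ℝ → Fin n → ℝ) (t : ℝ) : ℝ :=
  (N : ℝ) * (deriv qm t ⬝ᵥ Mm (qm t) *ᵥ deriv qm t)
    + ∑ i, deriv (qs i) t ⬝ᵥ Ms i (qs i t) *ᵥ deriv (qs i) t
    + ∑ i, (qm t - (qs i t - γ i)) ⬝ᵥ Kp i *ᵥ (qm t - (qs i t - γ i))
    + N * delayFunctional h (fun u => deriv qm u ⬝ᵥ Rm *ᵥ deriv qm u) t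
    + ∑ i, delayFunctional h (fun u => deriv (qs i) u ⬝ᵥ Rs i *ᵥ deriv (qs i) u) t

variable {Mm : (Fin n → ℝ) → Matrix (Fin n) (Fin n) ℝ}
  {Ms : Fin N → (Fin n → ℝ) → Matrix (Fin n) (Fin n) ℝ}
  {Cm : (Fin n → ℝ) → (Fin n → ℝ) → Matrix (Fin n) (Fin n) ℝ}
  {Cs : Fin N → (Fin n → ℝ) → (Fin n → ℝ) → Matrix (Fin n) (Fin n) ℝ}
  {Kp : Fin N → Matrix (Fin n) (Fin n) ℝ} {Rm : Matrix (Fin n) (Fin n) ℝ}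
  {Rs : Fin N → Matrix (Fin n) (Fin n) ℝ} {γ : Fin N → Fin n → ℝ}
  {qm : ℝ → Fin n → ℝ} {qs : Fin N → ℝ → Fin n → ℝ}

lemma hasDerivAt_teleopStorage (hP1m : PropP1 Mm) (hP1s : ∀ i, PropP1 (Ms i))
    (hP2m : PropP2 Mm Cm) (hP2s : ∀ i, PropP2 (Ms i) (Cs i)) (hqm : ContDiff ℝ 2 qm)
    (hqs : ∀ i, ContDiff ℝ 2 (qs i)) (hKp : ∀ i, (Kp i).PosDef) (h t : ℝ) :
    HasDerivAt (teleopStorage h Mm Ms Kp Rm Rs γ qm qs)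
      (N * (2 * (deriv qm t ⬝ᵥ
          (Mm (qm t) *ᵥ deriv (deriv qm) t + Cm (qm t) (deriv qm t) *ᵥ deriv qm t)))
        + ∑ i, 2 * (deriv (qs i) t ⬝ᵥ (Ms i (qs i t) *ᵥ deriv (deriv (qs i)) t
          + Cs i (qs i t) (deriv (qs i) t) *ᵥ deriv (qs i) t))
        + ∑ i, 2 * ((deriv qm t - deriv (qs i) t) ⬝ᵥ Kp i *ᵥ (qm t - (qs i t - γ i)))
        + N * (h * (deriv qm t ⬝ᵥ Rm *ᵥ deriv qm t)
          - ∫ u in (t - h)..t, deriv qm u ⬝ᵥ Rm *ᵥ deriv qm u)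
        + ∑ i, (h * (deriv (qs i) t ⬝ᵥ Rs i *ᵥ deriv (qs i) t)
          - ∫ u in (t - h)..t, deriv (qs i) u ⬝ᵥ Rs i *ᵥ deriv (qs i) u)) t := by
  obtain ⟨hdm, -, hcm⟩ := hasDerivAt_deriv_of_contDiff_two hqm t
  refine ((((hasDerivAt_kinetic hP1m hP2m hqm t).const_mul _).add
    (HasDerivAt.fun_sum fun i _ => hasDerivAt_kinetic (hP1s i) (hP2s i) (hqs i) t)).add
    (HasDerivAt.fun_sum fun i _ => ?_)).add
    ((hasDerivAt_delayFunctional (by fun_prop) h t).const_mul _) |>.add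
    (HasDerivAt.fun_sum fun i _ => hasDerivAt_delayFunctional ?_ h t)
  · exact HasDerivAt.dotProduct_mulVec_self (hKp i).isSymm_real
      (hdm.sub ((hasDerivAt_deriv_of_contDiff_two (hqs i) t).1.sub_const _))
  · have := (hasDerivAt_deriv_of_contDiff_two (hqs i) t).2.2
    fun_prop

lemma teleopStorage_lower (hKp : ∀ i, (Kp i).PosDef) (hRm : Rm.PosDef) (hRs : ∀ i, (Rs i).PosDef)
    (hqm : ContDiff ℝ 2 qm) (hqs : ∀ i, ContDiff ℝ 2 (qs i)) {h : ℝ} (hh : 0 ≤ h) (t : ℝ) :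
    (N : ℝ) * (deriv qm t ⬝ᵥ Mm (qm t) *ᵥ deriv qm t)
      + ∑ i, deriv (qs i) t ⬝ᵥ Ms i (qs i t) *ᵥ deriv (qs i) t
    ≤ teleopStorage h Mm Ms Kp Rm Rs γ qm qs t := by
  have hcm := (hasDerivAt_deriv_of_contDiff_two hqm t).2.2
  have hcs := fun i => (hasDerivAt_deriv_of_contDiff_two (hqs i) t).2.2
  have h1 : 0 ≤ ∑ i, (qm t - (qs i t - γ i)) ⬝ᵥ Kp i *ᵥ (qm t - (qs i t - γ i)) :=
    Finset.sum_nonneg fun i _ => (hKp i).dotProduct_mulVec_self_nonneg _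
  have h2 := mul_nonneg (Nat.cast_nonneg (α := ℝ) N)
    (delayFunctional_bounds (φ := fun u => deriv qm u ⬝ᵥ Rm *ᵥ deriv qm u) (by fun_prop)
      (fun u => hRm.dotProduct_mulVec_self_nonneg _) hh t).1
  have h3 : 0 ≤ ∑ i,
      delayFunctional h (fun u => deriv (qs i) u ⬝ᵥ Rs i *ᵥ deriv (qs i) u) t :=
    Finset.sum_nonneg fun i _ => (delayFunctional_bounds (by have := hcs i; fun_prop)
      (fun u => (hRs i).dotProduct_mulVec_self_nonneg _) hh t).1
  unfold teleopStorage
  linarith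

/-- The storage function is controlled by the present velocities, the coordination errors and the
energy dissipated over the last delay window. -/
lemma exists_teleopStorage_le (hP1m : PropP1 Mm) (hP1s : ∀ i, PropP1 (Ms i)) (hRm : Rm.PosDef)
    (hRs : ∀ i, (Rs i).PosDef) (hqm : ContDiff ℝ 2 qm) (hqs : ∀ i, ContDiff ℝ 2 (qs i))
    {h : ℝ} (hh : 0 ≤ h) {w : ℝ → ℝ} (hw : Continuous w) (hwm : ∀ t, ‖deriv qm t‖ ^ 2 ≤ w t)
    (hws : ∀ i t, ‖deriv (qs i) t‖ ^ 2 ≤ w t) (L D : ℝ) :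
    ∃ B, ∀ t, w t ≤ D → ∫ u in (t - h)..t, w u ≤ L → (∀ i, ‖qm t - (qs i t - γ i)‖ ≤ D) →
      teleopStorage h Mm Ms Kp Rm Rs γ qm qs t ≤ B := by
  have hcm := (hasDerivAt_deriv_of_contDiff_two hqm 0).2.2
  have hcs := fun i => (hasDerivAt_deriv_of_contDiff_two (hqs i) 0).2.2
  obtain ⟨_, bm, _, hbm, hMm⟩ := hP1m.exists_bounds
  choose _ bs _ hbs hMs using fun i => (hP1s i).exists_bounds
  choose κ hκ hKple using fun i => exists_dotProduct_mulVec_self_le (Kp i)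
  obtain ⟨r, hr, hRmle⟩ := exists_dotProduct_mulVec_self_le Rm
  choose ρ hρ hRsle using fun i => exists_dotProduct_mulVec_self_le (Rs i)
  have hdelay : ∀ (v : ℝ → Fin n → ℝ) (R : Matrix (Fin n) (Fin n) ℝ) (r t : ℝ), Continuous v →
      R.PosDef → 0 < r → (∀ x, x ⬝ᵥ R *ᵥ x ≤ r * ‖x‖ ^ 2) → (∀ t, ‖v t‖ ^ 2 ≤ w t) →
      ∫ u in (t - h)..t, w u ≤ L → delayFunctional h (fun u => v u ⬝ᵥ R *ᵥ v u) t ≤ h * (r * L) :=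
    fun v R r t hv hR hr hle hvw hL => by
      have hc : Continuous fun u => v u ⬝ᵥ R *ᵥ v u := by fun_prop
      refine (delayFunctional_bounds hc (fun u => hR.dotProduct_mulVec_self_nonneg _) hh t).2.trans ?_
      refine mul_le_mul_of_nonneg_left ?_ hh
      calc ∫ u in (t - h)..t, v u ⬝ᵥ R *ᵥ v u ≤ ∫ u in (t - h)..t, r * w u :=
            intervalIntegral.integral_mono_on (by linarith) (hc.intervalIntegrable _ _)
              ((hw.const_mul r).intervalIntegrable _ _)
              fun u _ => (hle _).trans (mul_le_mul_of_nonneg_left (hvw u) hr.le)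
        _ = r * ∫ u in (t - h)..t, w u := intervalIntegral.integral_const_mul _ _
        _ ≤ r * L := mul_le_mul_of_nonneg_left hL hr.le
  refine ⟨N * (bm * D) + ∑ i, bs i * D + ∑ i, κ i * D ^ 2 + N * (h * (r * L))
    + ∑ i, h * (ρ i * L), fun t hwD hL hD => ?_⟩
  unfold teleopStorage
  gcongr with i _ i _ i _
  · exact (hMm _ _).2.trans (by gcongr; exact (hwm t).trans hwD)
  · exact (hMs i _ _).2.trans (mul_le_mul_of_nonneg_left ((hws i t).trans hwD) (hbs i).le)
  · exact (hKple i _).trans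
      (mul_le_mul_of_nonneg_left (pow_le_pow_left₀ (norm_nonneg _) (hD i) 2) (hκ i).le)
  · exact hdelay _ Rm r t hcm hRm hr hRmle hwm hL
  · exact hdelay _ (Rs i) (ρ i) t (hcs i) (hRs i) (hρ i) (hRsle i) (hws i) hL

end Storage
/-- Theorem 2, Claim 2 (TOD, bounded forces): under properties P1–P3, the network
timing, the TOD protocol with errors η_i and reset law, the TOD closed-loop
dynamics and the LMIs Ω_i < 0 and Σ_i < 0, if the external forces are bounded on
[t_0,∞) then the velocities q̇_m and q̇_{si} are bounded on [t_0,∞). -/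
theorem tod_bounded_forces_bounded_velocities
    {n N : ℕ} (hn : 1 ≤ n) (hN : 2 ≤ N)
    (Mm : (Fin n → ℝ) → Matrix (Fin n) (Fin n) ℝ)
    (Ms : Fin N → (Fin n → ℝ) → Matrix (Fin n) (Fin n) ℝ)
    (Cm : (Fin n → ℝ) → (Fin n → ℝ) → Matrix (Fin n) (Fin n) ℝ)
    (Cs : Fin N → (Fin n → ℝ) → (Fin n → ℝ) → Matrix (Fin n) (Fin n) ℝ)
    -- network timing (Assumption 1)
    (MATI MAD : ℝ) (hMATI : 0 < MATI) (hMAD : 0 ≤ MAD)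
    (s : ℕ → ℝ) (hs0 : s 0 = 0) (hsmono : StrictMono s)
    (hsb : ∀ k, s (k+1) - s k ≤ MATI) (hstend : Tendsto s atTop atTop)
    (T : ℕ → ℝ) (hT : ∀ k, 0 ≤ T k ∧ T k ≤ MAD)
    (tk : ℕ → ℝ) (htk : ∀ k, tk k = s k + T k) (htkmono : ∀ k, tk k < tk (k+1))
    (hM : ℝ) (hhM : hM = MATI + MAD)
    -- controller gains and formation offsets
    (Kp Kd : Fin N → Matrix (Fin n) (Fin n) ℝ)
    (hKp : ∀ i, (Kp i).PosDef) (hKd : ∀ i, (Kd i).PosDef)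
    (γ : Fin N → Fin n → ℝ)
    -- trajectories and external forces
    (qm : ℝ → Fin n → ℝ) (qs : Fin N → ℝ → Fin n → ℝ)
    (hqm : ContDiff ℝ 2 qm) (hqs : ∀ i, ContDiff ℝ 2 (qs i))
    (fm : ℝ → Fin n → ℝ) (fs : Fin N → ℝ → Fin n → ℝ)
    -- TOD protocol: weights, network-induced errors, scheduling and reset law
    (Q : Fin N → Matrix (Fin n) (Fin n) ℝ) (hQ : ∀ i, (Q i).PosDef)
    (η : Fin N → ℝ → Fin n → ℝ)
    (hηconst : ∀ i k, ∀ t ∈ Set.Ico (tk k) (tk (k+1)), η i t = η i (tk k))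
    (hη0 : ∀ i, η i (tk 0) = -(qs i (s 0)))
    (istar : ℕ → Fin N)
    (hTOD : ∀ k i, η i (tk k) ⬝ᵥ (Q i).mulVec (η i (tk k)) ≤
      η (istar k) (tk k) ⬝ᵥ (Q (istar k)).mulVec (η (istar k) (tk k)))
    (hreset : ∀ k i, η i (tk (k+1)) =
      (if i = istar k then 0 else η i (tk k)) + (qs i (s k) - qs i (s (k+1))))
    -- TOD closed-loop dynamics on each interval [t_k, t_{k+1})
    (hdynm : ∀ k : ℕ, ∀ t ∈ Set.Ico (tk k) (tk (k+1)), fm t =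
      (Mm (qm t)).mulVec (deriv (deriv qm) t)
      + (Cm (qm t) (deriv qm t)).mulVec (deriv qm t)
      + (N : ℝ)⁻¹ • (∑ i, (Kd i).mulVec (deriv qm t))
      - (N : ℝ)⁻¹ • (∑ i ∈ Finset.univ.filter (fun j => j ≠ istar k),
          (Kp i).mulVec (η i t))
      + (N : ℝ)⁻¹ • (∑ i, (Kp i).mulVec (qm t - qs i (s k))))
    (hdyns : ∀ k : ℕ, ∀ t ∈ Set.Ico (tk k) (tk (k+1)), ∀ i, fs i t =
      (Ms i (qs i t)).mulVec (deriv (deriv (qs i)) t)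
      + (Cs i (qs i t) (deriv (qs i) t)).mulVec (deriv (qs i) t)
      + (Kd i).mulVec (deriv (qs i) t)
      + (Kp i).mulVec ((qs i t - γ i) - qm (s k)))
    -- TOD LMI conditions: Ω_i < 0 and Σ_i < 0
    (Rm : Matrix (Fin n) (Fin n) ℝ) (hRm : Rm.PosDef)
    (Rs G U : Fin N → Matrix (Fin n) (Fin n) ℝ)
    (hRs : ∀ i, (Rs i).PosDef) (hG : ∀ i, (G i).PosDef) (hU : ∀ i, (U i).PosDef)
    (hΩ : ∀ i, (-(OmegaTOD (N : ℝ) (Q i) (U i) (G i))).PosDef)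
    (hSigma : ∀ i, (-(SigmaTOD hM i Kp Kd Rm Rs G U)).PosDef)
    -- robot properties P1–P3
    (hP1m : PropP1 Mm) (hP1s : ∀ i, PropP1 (Ms i))
    (hP2m : PropP2 Mm Cm) (hP2s : ∀ i, PropP2 (Ms i) (Cs i))
    (hP3m : PropP3 Cm) (hP3s : ∀ i, PropP3 (Cs i))
    -- external forces in L^∞ on [t_0, ∞)
    (hforces : ∃ Δ : ℝ, ∀ t ≥ tk 0, ‖fm t‖ ≤ Δ ∧ ∀ i, ‖fs i t‖ ≤ Δ) :
    ∃ B : ℝ, ∀ t ≥ tk 0, ‖deriv qm t‖ ≤ B ∧ ∀ i, ‖deriv (qs i) t‖ ≤ B := by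
  obtain ⟨Δ, hΔ⟩ := hforces
  have hN1 : 1 ≤ N := by omega
  have hM0 : 0 < hM := by linarith
  have hst : ∀ k, s k ≤ tk k := fun k => by linarith [htk k, (hT k).1]
  have hts : ∀ k, tk (k + 1) - s k ≤ hM := fun k => by
    linarith [htk (k + 1), (hT (k + 1)).2, hsb k]
  have hgap : ∀ k, tk (k + 1) - tk k ≤ hM := fun k => by linarith [hst k, hts k]
  have htend : Tendsto tk atTop atTop := tendsto_atTop_mono hst hstend
  have hsm : StrictMono tk := strictMono_nat_of_lt_succ htkmono
  have htk0 : ∀ k, tk 0 ≤ tk k := fun k => hsm.monotone (Nat.zero_le k)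
  have hdm := fun t => (hasDerivAt_deriv_of_contDiff_two hqm t).1
  have hds := fun i t => (hasDerivAt_deriv_of_contDiff_two (hqs i) t).1
  have hcm := (hasDerivAt_deriv_of_contDiff_two hqm 0).2.2
  have hcs := fun i => (hasDerivAt_deriv_of_contDiff_two (hqs i) 0).2.2
  set w : ℝ → ℝ := fun t => ‖deriv qm t‖ ^ 2 + ∑ i, ‖deriv (qs i) t‖ ^ 2 with hw
  have hwc : Continuous w := by fun_prop
  have hwm : ∀ t, ‖deriv qm t‖ ^ 2 ≤ w t := fun t =>
    le_add_of_nonneg_right (Finset.sum_nonneg fun i _ => sq_nonneg _)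
  have hws : ∀ i t, ‖deriv (qs i) t‖ ^ 2 ≤ w t := fun i t =>
    (Finset.single_le_sum (f := fun j => ‖deriv (qs j) t‖ ^ 2) (fun j _ => sq_nonneg _)
      (Finset.mem_univ i)).trans (le_add_of_nonneg_left (sq_nonneg _))
  have hw0 : ∀ t, 0 ≤ w t := fun t => (sq_nonneg _).trans (hwm t)
  -- the three network-dependent parts of the functional
  set SQ : ℕ → ℝ := fun k => ∑ i, η i (tk k) ⬝ᵥ Q i *ᵥ η i (tk k) with hSQ
  set W : ℕ → ℝ := fun k => ∑ i ∈ Finset.univ.filter (fun j => j ≠ istar k),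
    η i (tk k) ⬝ᵥ U i *ᵥ η i (tk k) with hW
  have hW0 : ∀ k, 0 ≤ W k := fun k =>
    Finset.sum_nonneg fun i _ => (hU i).dotProduct_mulVec_self_nonneg _
  set V : ℕ → ℝ → ℝ := fun k t =>
    hM * ∑ i, ∫ u in (s k)..t, deriv (qs i) u ⬝ᵥ G i *ᵥ deriv (qs i) u with hV
  have hGc : ∀ i, Continuous fun u => deriv (qs i) u ⬝ᵥ G i *ᵥ deriv (qs i) u := fun i => by
    have := hcs i; fun_prop
  have hV0 : ∀ k t, s k ≤ t → 0 ≤ V k t := fun k t ht => mul_nonneg hM0.le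
    (Finset.sum_nonneg fun i _ => intervalIntegral.integral_nonneg ht
      fun u _ => (hG i).dotProduct_mulVec_self_nonneg _)
  set S : ℝ → ℝ := teleopStorage hM Mm Ms Kp Rm Rs γ qm qs with hS
  set E : ℕ → ℝ → ℝ := fun k t =>
    S t + V k t + SQ k + (tk k - t) / (tk (k + 1) - tk k) * W k with hE
  set ν : ℕ → ℝ := fun k => ∑ i, ‖η i (tk k)‖ ^ 2 with hν
  have hν0 : ∀ k, 0 ≤ ν k := fun k => Finset.sum_nonneg fun i _ => sq_nonneg _
  obtain ⟨c, ε₁, hc, hε₁, hdiss⟩ := exists_flow_dissipation hN1 hKp hSigma γ Δ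
  obtain ⟨ε₂, hε₂, hjmp⟩ := exists_sum_omegaTOD_le hN hQ hΩ
  have hflow : ∀ k x y, tk k ≤ x → x ≤ y → y ≤ tk (k + 1) →
      E k y ≤ E k x + c * (y - x) - ε₁ * ∫ u in x..y, w u := fun k x y hx hxy hy => by
    have hδ : 0 < tk (k + 1) - tk k := sub_pos.2 (htkmono k)
    have hderiv : ∀ t, HasDerivAt (E k) _ t := fun t =>
      (((hasDerivAt_teleopStorage (γ := γ) (Rm := Rm) (Rs := Rs) hP1m hP1s hP2m hP2s hqm hqs hKp
        hM t).add ((HasDerivAt.fun_sum fun i _ =>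
          hasDerivAt_integral_of_continuous (hGc i) (s k) t).const_mul hM)).add_const (SQ k)).add
      ((((hasDerivAt_id t).const_sub (tk k)).div_const (tk (k + 1) - tk k)).mul_const (W k))
    have hle := sub_le_integral_of_hasDerivAt_le (φ := fun t => c - ε₁ * w t) hxy (by fun_prop)
      hderiv fun t ht => by
        have ht' : t ∈ Set.Ico (tk k) (tk (k + 1)) := ⟨hx.trans ht.1.le, ht.2.trans_le hy⟩
        have htk : tk 0 ≤ t := (htk0 k).trans ht'.1
        have hst' : s k ≤ t := (hst k).trans ht'.1
        have hth : t - hM ≤ s k := by linarith [hts k, ht'.2]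
        have hd := hdiss (istar k) (deriv qm t) (qm t - qm (s k)) (fm t)
          (Mm (qm t) *ᵥ deriv (deriv qm) t + Cm (qm t) (deriv qm t) *ᵥ deriv qm t)
          (fun i => deriv (qs i) t) (fun i => qs i t - qs i (s k))
          (fun i => qm t - (qs i t - γ i)) (fun i => η i (tk k)) (fun i => fs i t)
          (fun i => Ms i (qs i t) *ᵥ deriv (deriv (qs i)) t
            + Cs i (qs i t) (deriv (qs i) t) *ᵥ deriv (qs i) t) (hΔ t htk).1 (hΔ t htk).2
          (by
            rw [hdynm k t ht']
            congr 3
            · exact Finset.sum_congr rfl fun i _ => by rw [hηconst i k t ht']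
            · exact funext fun i => congrArg (Kp i *ᵥ ·) (by abel))
          (fun i => by
            rw [hdyns k t ht' i]
            congr 2; abel)
        have hJ : ∀ (x : ℝ → Fin n → ℝ) (R : Matrix (Fin n) (Fin n) ℝ), ContDiff ℝ 2 x →
            R.PosDef → hM⁻¹ * ((x t - x (s k)) ⬝ᵥ R *ᵥ (x t - x (s k)))
              ≤ ∫ u in (t - hM)..t, deriv x u ⬝ᵥ R *ᵥ deriv x u := fun x R hx hR => by
          have hxc := (hasDerivAt_deriv_of_contDiff_two hx 0).2.2
          refine (hR.dotProduct_mulVec_sub_le (fun τ => (hasDerivAt_deriv_of_contDiff_two hx τ).1)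
            hxc hst' hM0 (by linarith)).trans ?_
          exact integral_mono_interval_of_nonneg (by fun_prop)
            (fun u => hR.dotProduct_mulVec_self_nonneg _) hth hst' le_rfl
        have hJm := mul_le_mul_of_nonneg_left (hJ qm Rm hqm hRm) (Nat.cast_nonneg (α := ℝ) N)
        have hJs := Finset.sum_le_sum fun i (_ : i ∈ Finset.univ) => hJ (qs i) (Rs i) (hqs i) (hRs i)
        have hWle : hM⁻¹ * W k ≤ (tk (k + 1) - tk k)⁻¹ * W k :=
          mul_le_mul_of_nonneg_right (inv_anti₀ hδ (hgap k)) (hW0 k)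
        have hneg : (-1 : ℝ) / (tk (k + 1) - tk k) = -(tk (k + 1) - tk k)⁻¹ := by
          rw [neg_div, one_div]
        rw [hneg]
        simp only [Finset.sum_sub_distrib, mul_sub] at hd ⊢
        simp only [hw, hW] at hd hWle ⊢
        linarith
    rw [intervalIntegral.integral_sub (by simp) ((hwc.const_mul ε₁).intervalIntegrable _ _),
      intervalIntegral.integral_const_mul, intervalIntegral.integral_const, smul_eq_mul] at hle
    linarith
  have hjump : ∀ k, E (k + 1) (tk (k + 1)) ≤ E k (tk (k + 1)) - ε₂ * ν (k + 1) := fun k => by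
    have hδ : tk (k + 1) - tk k ≠ 0 := (sub_pos.2 (htkmono k)).ne'
    have hone : (tk k - tk (k + 1)) / (tk (k + 1) - tk k) = -1 := by
      rw [← neg_sub, neg_div, div_self hδ]
    have hj := hjmp (istar k) (fun i => η i (tk k)) (fun i => qs i (s k) - qs i (s (k + 1)))
      (fun i => η i (tk (k + 1))) (hTOD k) (fun i => hreset k i)
    have hVd : ∑ i, (qs i (s k) - qs i (s (k + 1))) ⬝ᵥ G i *ᵥ (qs i (s k) - qs i (s (k + 1)))
        ≤ V k (tk (k + 1)) - V (k + 1) (tk (k + 1)) := by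
      simp only [hV]
      rw [← mul_sub, ← Finset.sum_sub_distrib, Finset.mul_sum]
      refine Finset.sum_le_sum fun i _ => ?_
      have hJ := (hG i).dotProduct_mulVec_sub_le (hds i) (hcs i) (hsmono (Nat.lt_succ_self k)).le
        hM0 (by linarith [hsb k])
      rw [inv_mul_le_iff₀ hM0] at hJ
      rw [← neg_sub (qs i (s (k + 1))), mulVec_neg, neg_dotProduct_neg]
      have hadd := intervalIntegral.integral_add_adjacent_intervals
        ((hGc i).intervalIntegrable (μ := volume) (s k) (s (k + 1)))
        ((hGc i).intervalIntegrable (s (k + 1)) (tk (k + 1)))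
      rw [← hadd, add_sub_cancel_right]
      exact hJ
    simp only [hE, hone, sub_self, zero_div, zero_mul, add_zero]
    simp only [hSQ, hW, hν]
    linarith
  have hwin : ∀ L, ∃ B, ∀ a, tk 0 ≤ a → ∫ u in a..(a + 4 * hM), w u ≤ L →
      ∃ b ∈ Set.Icc (a + 3 * hM) (a + 4 * hM), ∀ l, b ∈ Set.Ico (tk l) (tk (l + 1)) → ν l ≤ L →
        E l b ≤ B := fun L => by
    obtain ⟨De, hDe, hcoord⟩ := exists_pos_forall_of_forall_exists_pos'
      (P := fun i B => ∀ a, tk 0 ≤ a → ∫ u in a..(a + 4 * hM), w u ≤ L →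
        ∀ t ∈ Set.Icc (a + 3 * hM) (a + 4 * hM), ‖qm t - (qs i t - γ i)‖ ≤ B)
      (fun i a b hab hP a' ha' hL t ht => (hP a' ha' hL t ht).trans hab) fun i => by
        obtain ⟨B, hB⟩ := exists_bound_coordination_error (hP1s i) (hP2s i) (hP3s i) hqm (hqs i)
          (hKp i) (Kd := Kd i) (γ := γ i) (f := fs i) (Δ := Δ) (t₀ := tk 0) hM0 hwc hwm (hws i)
          (fun t ht => by
            obtain ⟨k, hk⟩ := exists_mem_Ico_of_tendsto_atTop htend ht
            exact ⟨(hΔ t ht).2 i, s k, ⟨by linarith [hts k, hk.2], (hst k).trans hk.1⟩,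
              hdyns k t hk i⟩) L
        exact ⟨max B 1, by positivity, fun a ha hL t ht => (hB a ha hL t ht).trans (le_max_left _ _)⟩
    obtain ⟨BS, hBS⟩ := exists_teleopStorage_le (Kp := Kp) (γ := γ) hP1m hP1s hRm hRs hqm hqs
      hM0.le hwc hwm hws L (max De (L / hM))
    choose g hg hGle using fun i => exists_dotProduct_mulVec_self_le (G i)
    choose r hr hQle using fun i => exists_dotProduct_mulVec_self_le (Q i)
    refine ⟨BS + hM * (∑ i, g i * L) + ∑ i, r i * L, fun a ha hL => ?_⟩
    obtain ⟨b, hb, hbw⟩ := exists_mul_le_integral hwc (a := a + 3 * hM) (b := a + 4 * hM)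
      (by linarith)
    have hsub : ∀ x y, a ≤ x → x ≤ y → y ≤ a + 4 * hM → ∫ u in x..y, w u ≤ L :=
      fun x y hx hxy hy => (integral_mono_interval_of_nonneg hwc hw0 hx hxy hy).trans hL
    refine ⟨b, hb, fun l hl hνl => ?_⟩
    have hsl : s l ≤ b := (hst l).trans hl.1
    have hal : a ≤ s l := by linarith [hts l, hl.2, hb.1]
    have hwb : w b ≤ L / hM := by
      rw [le_div_iff₀ hM0]
      have := hsub _ _ (by linarith) (by linarith : a + 3 * hM ≤ a + 4 * hM) le_rfl
      linarith
    have h1 : S b ≤ BS := hBS b (hwb.trans (le_max_right _ _))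
      (hsub _ _ (by linarith [hb.1]) (by linarith) hb.2)
      fun i => (hcoord i a ha hL b hb).trans (le_max_left _ _)
    have h2 : V l b ≤ hM * ∑ i, g i * L := by
      refine mul_le_mul_of_nonneg_left (Finset.sum_le_sum fun i _ => ?_) hM0.le
      calc ∫ u in (s l)..b, deriv (qs i) u ⬝ᵥ G i *ᵥ deriv (qs i) u
          ≤ ∫ u in (s l)..b, g i * w u :=
            intervalIntegral.integral_mono_on hsl ((hGc i).intervalIntegrable _ _)
              ((hwc.const_mul _).intervalIntegrable _ _)
              fun u _ => (hGle i _).trans (mul_le_mul_of_nonneg_left (hws i u) (hg i).le)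
        _ = g i * ∫ u in (s l)..b, w u := intervalIntegral.integral_const_mul _ _
        _ ≤ g i * L := mul_le_mul_of_nonneg_left (hsub _ _ hal hsl hb.2) (hg i).le
    have h3 : SQ l ≤ ∑ i, r i * L := Finset.sum_le_sum fun i _ =>
      (hQle i _).trans (mul_le_mul_of_nonneg_left ((Finset.single_le_sum
        (f := fun j => ‖η j (tk l)‖ ^ 2) (fun j _ => sq_nonneg _) (Finset.mem_univ i)).trans hνl)
        (hr i).le)
    have h4 : (tk l - b) / (tk (l + 1) - tk l) * W l ≤ 0 :=
      mul_nonpos_of_nonpos_of_nonneg (div_nonpos_of_nonpos_of_nonneg (by linarith [hl.1])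
        (by linarith [htkmono l])) (hW0 l)
    simp only [hE]
    linarith
  obtain ⟨B, hB⟩ := exists_bound_of_hybrid_dissipation (E := E) (w := w) (ν := ν) (c := c)
    (ε := min ε₁ ε₂) htkmono hgap htend hwc hw0 hν0 hc (lt_min hε₁ hε₂)
    (fun k x y hx hxy hy => (hflow k x y hx hxy hy).trans (sub_le_sub_left
      (mul_le_mul_of_nonneg_right (min_le_left _ _)
        (intervalIntegral.integral_nonneg hxy fun u _ => hw0 u)) _))
    (fun k => (hjump k).trans (sub_le_sub_left
      (mul_le_mul_of_nonneg_right (min_le_right _ _) (hν0 _)) _)) hwin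
  obtain ⟨am, _, ham, _, hMm⟩ := hP1m.exists_bounds
  choose as _ has _ hMs using fun i => (hP1s i).exists_bounds
  have hkin : ∀ t ≥ tk 0, am * ‖deriv qm t‖ ^ 2 + ∑ i, as i * ‖deriv (qs i) t‖ ^ 2 ≤ B :=
    fun t ht => by
      obtain ⟨k, hk⟩ := exists_mem_Ico_of_tendsto_atTop htend ht
      have hδ : 0 < tk (k + 1) - tk k := sub_pos.2 (htkmono k)
      have h1 : E k t ≤ B := hB k t ⟨hk.1, hk.2.le⟩
      have h2 := teleopStorage_lower (Mm := Mm) (Ms := Ms) (γ := γ) hKp hRm hRs hqm hqs hM0.le t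
      have h3 := hV0 k t ((hst k).trans hk.1)
      have h4 : W k ≤ SQ k := (Finset.sum_le_sum fun i _ =>
        dotProduct_mulVec_le_of_omegaTOD hN (hQ i) (hΩ i) _).trans
        (Finset.sum_le_univ_sum_of_nonneg fun i => (hQ i).dotProduct_mulVec_self_nonneg _)
      have h5 : -1 * W k ≤ (tk k - t) / (tk (k + 1) - tk k) * W k :=
        mul_le_mul_of_nonneg_right (by rw [le_div_iff₀ hδ]; linarith [hk.2]) (hW0 k)
      have h6 : am * ‖deriv qm t‖ ^ 2 ≤ N * (deriv qm t ⬝ᵥ Mm (qm t) *ᵥ deriv qm t) := by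
        have h7 := (hMm (qm t) (deriv qm t)).1
        have h8 : (1 : ℝ) ≤ N := by exact_mod_cast hN1
        exact h7.trans (le_mul_of_one_le_left ((by positivity : (0 : ℝ) ≤ _).trans h7) h8)
      have h9 := Finset.sum_le_sum fun i (_ : i ∈ Finset.univ) =>
        (hMs i (qs i t) (deriv (qs i) t)).1
      simp only [hE] at h1
      linarith
  have hsq : ∀ (a : ℝ) (x : Fin n → ℝ), 0 < a → a * ‖x‖ ^ 2 ≤ B → ‖x‖ ≤ 1 + B / a :=
    fun a x ha hx => by
      have : ‖x‖ ^ 2 ≤ B / a := by rw [le_div_iff₀ ha]; linarith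
      nlinarith [sq_nonneg (‖x‖ - 1)]
  have hsum0 : ∀ t, 0 ≤ ∑ i, as i * ‖deriv (qs i) t‖ ^ 2 := fun t =>
    Finset.sum_nonneg fun i _ => mul_nonneg (has i).le (sq_nonneg _)
  obtain ⟨D, hD, hbd⟩ := exists_pos_forall_of_forall_exists_pos'
    (P := fun i D => ∀ t ≥ tk 0, ‖deriv (qs i) t‖ ≤ D)
    (fun i a b hab hP t ht => (hP t ht).trans hab) fun i =>
      ⟨max (1 + B / as i) 1, by positivity, fun t ht => (hsq _ _ (has i)
        (((Finset.single_le_sum (f := fun j => as j * ‖deriv (qs j) t‖ ^ 2)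
          (fun j _ => mul_nonneg (has j).le (sq_nonneg _)) (Finset.mem_univ i)).trans
          (le_add_of_nonneg_left (by positivity))).trans (hkin t ht))).trans (le_max_left _ _)⟩
  exact ⟨max (1 + B / am) D, fun t ht =>
    ⟨(hsq _ _ ham ((le_add_of_nonneg_right (hsum0 t)).trans (hkin t ht))).trans (le_max_left _ _),
      fun i => (hbd i t ht).trans (le_max_right _ _)⟩⟩
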